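/- arXiv:2301.12248 — 3 statements merged into one kernel-verified Lean document; each statement's English description precedes it below -/
import Mathlib

section
/- Let A_F(n) = \sum_{k=0}^{n} (-1)^k 8^{n-k} \binom{n}{k} \sum_{l=0}^{k} \binom{k}{l}^3 (Zagier's sporadic sequence F). Then for every prime p \ge 3 and all positive integers n and r, we have A_F(p^r n) \equiv A_F(p^{r-1} n) (mod p^{2r}), i.e., p^{2r} divides A_F(p^r n) - A_F(p^{r-1} n). -/
/-- Zagier's sporadic sequence F. -/
def aperyF (n : ℕ) : ℤ :=
  ∑ k ∈ Finset.range (n + 1),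
    (-1) ^ k * 8 ^ (n - k) * (n.choose k : ℤ) *
      ∑ l ∈ Finset.range (k + 1), (k.choose l : ℤ) ^ 3

namespace SporadicF

open Finset
open scoped Nat

/-! ### Constant terms of Laurent polynomials in two variables -/

/-- The monomial with exponent `a`, as a Laurent polynomial in two variables. -/
noncomputable def mono (a : ℤ × ℤ) : AddMonoidAlgebra ℤ (ℤ × ℤ) := .single a 1

/-- The constant term of a Laurent polynomial in two variables. -/
noncomputable def constTerm : AddMonoidAlgebra ℤ (ℤ × ℤ) →+ ℤ :=
  (Finsupp.applyAddHom (0 : ℤ × ℤ)).comp AddMonoidAlgebra.coeffAddEquiv.toAddMonoidHom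

lemma constTerm_mono (a : ℤ × ℤ) : constTerm (mono a) = if a = 0 then 1 else 0 := by
  simp [constTerm, mono, Finsupp.single_apply]

lemma mono_zero : mono 0 = 1 := rfl

lemma mono_mul (a b : ℤ × ℤ) : mono a * mono b = mono (a + b) := by
  simp [mono, AddMonoidAlgebra.single_mul_single]

lemma mono_pow (a : ℤ × ℤ) (n : ℕ) : mono a ^ n = mono (n • a) := by
  induction n with
  | zero => simp [mono_zero]
  | succ n ih => rw [pow_succ, ih, mono_mul, succ_nsmul]

lemma constTerm_triple {ι : Type*} (s : Finset ι) (g : ι → ℤ) (hg : g.Injective)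
    (u v w : ι → ℤ) :
    constTerm ((∑ l ∈ s, u l • mono (g l • (1, 0))) * (∑ l ∈ s, v l • mono (g l • (0, 1))) *
      ∑ l ∈ s, w l • mono (g l • (-1, -1))) = ∑ l ∈ s, u l * v l * w l := by
  classical
  simp only [sum_mul, mul_sum, map_sum, smul_mul_assoc, mul_smul_comm, map_zsmul,
    mono_mul, constTerm_mono]
  refine sum_congr rfl fun a ha => ?_
  have key : ∀ b c, (g c • ((1 : ℤ), (0 : ℤ)) + g b • (0, 1) + g a • (-1, -1) = 0) ↔
      (c = a ∧ b = a) := by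
    intro b c
    simp only [Prod.ext_iff, Prod.fst_add, Prod.snd_add, Prod.smul_fst, Prod.smul_snd, smul_eq_mul,
      Prod.fst_zero, Prod.snd_zero]
    constructor
    · rintro ⟨h1, h2⟩
      exact ⟨hg (by lia), hg (by lia)⟩
    · rintro ⟨rfl, rfl⟩
      constructor <;> ring
  simp only [key, ite_and, smul_eq_mul]
  simp [ha]
  ring

lemma one_add_mono_pow (a : ℤ × ℤ) (k : ℕ) :
    (1 + mono a) ^ k = ∑ l ∈ range (k + 1), (k.choose l : ℤ) • mono ((l : ℤ) • a) := by
  rw [add_comm, add_pow]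
  refine sum_congr rfl fun l _ => ?_
  simp [mono_pow, mul_comm]

/-- The binomial coefficient `(2 * i).choose (i + m)`, extended by zero to all integers `m`. -/
def centralChoose (i : ℕ) (m : ℤ) : ℤ :=
  if 0 ≤ i + m then ((2 * i).choose (i + m).toNat : ℤ) else 0

lemma one_sub_mono_mul_pow (a : ℤ × ℤ) {i L : ℕ} (hL : i ≤ L) :
    ((1 - mono a) * (1 - mono (-a))) ^ i =
      ∑ m ∈ Ico (-L : ℤ) (L + 1), ((m.negOnePow : ℤ) * centralChoose i m) • mono (m • a) := by
  have h1 : mono a * mono (-a) = 1 := by rw [mono_mul, add_neg_cancel, mono_zero]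
  have h2 : (1 - mono a) * (1 - mono (-a)) = -(mono (-a)) * (-mono a + 1) ^ 2 := by
    linear_combination (mono a - 1 ) * h1
  have h3 : ∑ m ∈ Ico (-L : ℤ) (L + 1),
      ((m.negOnePow : ℤ) * centralChoose i m) • mono (m • a) =
      ∑ m ∈ Ico (-i : ℤ) (i + 1), ((m.negOnePow : ℤ) * centralChoose i m) • mono (m • a) := by
    refine (sum_subset (Ico_subset_Ico (by lia) (by lia)) fun m _ hm => ?_).symm
    have : centralChoose i m = 0 := by
      unfold centralChoose
      split_ifs with h
      · rw [Nat.choose_eq_zero_of_lt]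
        · rfl
        · simp only [mem_Ico, not_and, not_lt] at hm
          lia
      · rfl
    simp [this]
  rw [h3, h2, mul_pow, ← pow_mul, add_pow, mul_sum]
  refine sum_nbij' (fun l : ℕ => (l : ℤ) - i) (fun m : ℤ => (i + m).toNat) ?_ ?_ ?_ ?_ ?_
  · intro l hl
    simp only [mem_range, mem_Ico] at hl ⊢
    lia
  · intro m hm
    simp only [mem_range, mem_Ico] at hm ⊢
    lia
  · intro l _
    simp
  · intro m hm
    simp only [mem_Ico] at hm
    lia
  · intro l _
    have h4 : centralChoose i (l - i) = (2 * i).choose l := by simp [centralChoose]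
    have h5 : (((l : ℤ) - i).negOnePow : ℤ) = (-1) ^ i * (-1) ^ l := by
      rw [Int.negOnePow_sub]
      simp [Int.negOnePow_def, mul_comm]
    have h6 : mono (((l : ℤ) - i) • a) = mono (-a) ^ i * mono a ^ l := by
      rw [mono_pow, mono_pow, mono_mul, sub_smul]
      congr 1
      simp; abel
    rw [h4, h5, h6, neg_pow, neg_pow (mono a)]
    simp only [zsmul_eq_mul]
    push_cast
    ring

/-- The alternating sum of products of three central binomial rows. -/
noncomputable def tripleSum (i j k : ℕ) : ℤ :=
  ∑ m ∈ Ico (-(i + j + k : ℕ) : ℤ) ((i + j + k : ℕ) + 1),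
    (m.negOnePow : ℤ) * (centralChoose i m * centralChoose j m * centralChoose k m)

/-- The summand of `aperyF` in its expansion over triples. -/
noncomputable def term (f : Fin 3 → ℕ) : ℤ :=
  Nat.multinomial univ f * tripleSum (f 0) (f 1) (f 2)

theorem aperyF_eq_sum_term (n : ℕ) :
    aperyF n = ∑ f ∈ piAntidiag (univ : Finset (Fin 3)) n, term f := by
  set x := mono (1, 0) with hx
  set y := mono (0, 1) with hy
  set z := mono (-1, -1) with hz
  set F : Fin 3 → AddMonoidAlgebra ℤ (ℤ × ℤ) :=
    ![(1 - x) * (1 - mono (-(1, 0))), (1 - y) * (1 - mono (-(0, 1))),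
      (1 - z) * (1 - mono (-(-1, -1)))] with hF
  have hxyz : x * y * z = 1 := by simp [hx, hy, hz, mono_mul, ← mono_zero, ← Prod.zero_eq_mk]
  have hx' : y * z = mono (-(1, 0)) := by simp [hy, hz, mono_mul]
  have hy' : x * z = mono (-(0, 1)) := by simp [hx, hz, mono_mul]
  have hz' : x * y = mono (-(-1, -1)) := by simp [hx, hy, mono_mul]
  have hsum : -((1 + x) * (1 + y) * (1 + z)) + 8 = ∑ i, F i := by
    simp only [Fin.sum_univ_three, hF, Matrix.cons_val, ← hx', ← hy', ← hz']
    linear_combination (-4) * hxyz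
  have hL : constTerm ((-((1 + x) * (1 + y) * (1 + z)) + 8) ^ n) = aperyF n := by
    rw [add_pow, map_sum, aperyF]
    refine sum_congr rfl fun k _ => ?_
    have h1 : constTerm (((1 + x) * (1 + y) * (1 + z)) ^ k) =
        ∑ l ∈ range (k + 1), (k.choose l : ℤ) ^ 3 := by
      rw [mul_pow, mul_pow, hx, hy, hz, one_add_mono_pow, one_add_mono_pow, one_add_mono_pow,
        constTerm_triple _ _ Nat.cast_injective]
      exact sum_congr rfl fun l _ => by ring
    rw [← h1]
    refine (congrArg constTerm ?_).trans
      (map_zsmul constTerm ((-1) ^ k * 8 ^ (n - k) * (n.choose k : ℤ)) _)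
    rw [neg_pow, zsmul_eq_mul]
    push_cast
    ring
  rw [← hL, hsum, sum_pow_eq_sum_piAntidiag, map_sum]
  refine sum_congr rfl fun f hf => ?_
  rw [← nsmul_eq_mul, map_nsmul, term, nsmul_eq_mul]
  congr 1
  simp only [Fin.prod_univ_three, hF, Matrix.cons_val]
  rw [hx, hy, hz, one_sub_mono_mul_pow (L := f 0 + f 1 + f 2) _ (by lia),
    one_sub_mono_mul_pow (L := f 0 + f 1 + f 2) _ (by lia),
    one_sub_mono_mul_pow (L := f 0 + f 1 + f 2) _ (by lia)]
  refine (constTerm_triple _ id Function.injective_id _ _ _).trans ?_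
  refine sum_congr rfl fun m _ => ?_
  have : (m.negOnePow : ℤ) * m.negOnePow = 1 := by
    rw [← Units.val_mul, Int.units_mul_self, Units.val_one]
  linear_combination (m.negOnePow : ℤ) * centralChoose (f 0) m * centralChoose (f 1) m *
    centralChoose (f 2) m * this

/-! ### Dixon's identity -/

/-- The reciprocal of the factorial, extended by zero to the negative integers. -/
def invFact (z : ℤ) : ℚ := if 0 ≤ z then ((z.toNat)! : ℚ)⁻¹ else 0

lemma invFact_natCast (n : ℕ) : invFact n = (n ! : ℚ)⁻¹ := by simp [invFact]

lemma invFact_of_neg {z : ℤ} (hz : z < 0) : invFact z = 0 := by simp [invFact, hz]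

lemma mul_invFact (z : ℤ) : z * invFact z = invFact (z - 1) := by
  rcases lt_trichotomy z 0 with h | rfl | h
  · rw [invFact_of_neg h, invFact_of_neg (by lia), mul_zero]
  · rw [zero_sub, invFact_of_neg neg_one_lt_zero, Int.cast_zero, zero_mul]
  · obtain ⟨n, rfl⟩ : ∃ n : ℕ, z = n + 1 := ⟨(z - 1).toNat, by lia⟩
    have h1 : invFact ((n : ℤ) + 1) = ((n + 1)! : ℚ)⁻¹ := by exact_mod_cast invFact_natCast (n + 1)
    rw [h1, add_sub_cancel_right, invFact_natCast, Nat.factorial_succ]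
    have := Nat.factorial_ne_zero n
    push_cast
    field_simp

lemma centralChoose_eq (i : ℕ) (m : ℤ) :
    (centralChoose i m : ℚ) = (2 * i)! * (invFact (i + m) * invFact (i - m)) := by
  unfold centralChoose
  split_ifs with h
  · obtain ⟨l, hl⟩ : ∃ l : ℕ, (i : ℤ) + m = l := ⟨_, (Int.toNat_of_nonneg h).symm⟩
    have hm : (i : ℤ) - m = (2 * i : ℕ) - (l : ℤ) := by push_cast; lia
    rw [hl, hm, invFact_natCast, Int.toNat_natCast]
    rcases le_or_gt l (2 * i) with h' | h'
    · rw [← Nat.cast_sub h', invFact_natCast, Int.cast_natCast, Nat.cast_choose ℚ h']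
      field_simp
    · rw [Nat.choose_eq_zero_of_lt h', invFact_of_neg (by lia)]
      simp
  · rw [invFact_of_neg (by lia : (i : ℤ) + m < 0)]
    simp

/-- The summand of Dixon's identity in its normalised form. -/
def dixonTerm (a b c : ℕ) (m : ℤ) : ℚ :=
  (m.negOnePow : ℤ) * (invFact (a + m) * invFact (a - m)) * (invFact (b + m) * invFact (b - m)) *
    (invFact (c + m) * invFact (c - m))

/-- The telescoping companion of `dixonTerm`. -/
def dixonCompanion (a b c : ℕ) (m : ℤ) : ℚ :=
  (m.negOnePow : ℤ) * (invFact (a + m) * invFact (a + 1 - m)) *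
    (invFact (b + m - 1) * invFact (b - m)) * (invFact (c + m - 1) * invFact (c - m))

lemma dixonTerm_succ (a b c : ℕ) (m : ℤ) :
    2 * ((a + 1 : ℚ) * (a + 1 + b) * (a + 1 + c) * dixonTerm (a + 1) b c m -
      (a + 1 + b + c) * dixonTerm a b c m) =
      dixonCompanion a b c m - dixonCompanion a b c (m + 1) := by
  have e1 := mul_invFact (a + 1 + m)
  have e2 := mul_invFact (a + 1 - m)
  have e3 := mul_invFact (b + m)
  have e4 := mul_invFact (b - m)
  have e5 := mul_invFact (c + m)
  have e6 := mul_invFact (c - m)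
  rw [show (a : ℤ) + 1 + m - 1 = a + m by ring] at e1
  rw [show (a : ℤ) + 1 - m - 1 = a - m by ring] at e2
  unfold dixonTerm dixonCompanion
  rw [Int.negOnePow_succ, show (a : ℤ) + (m + 1) = a + 1 + m by ring,
    show (a : ℤ) + 1 - (m + 1) = a - m by ring, show (b : ℤ) + (m + 1) - 1 = b + m by ring,
    show (b : ℤ) - (m + 1) = b - m - 1 by ring, show (c : ℤ) + (m + 1) - 1 = c + m by ring,
    show (c : ℤ) - (m + 1) = c - m - 1 by ring, ← e1, ← e2, ← e3, ← e4, ← e5, ← e6]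
  push_cast
  ring

lemma sum_dixonTerm (a b c L : ℕ) (hb : b ≤ L) :
    ∑ m ∈ Ico (-L : ℤ) (L + 1), dixonTerm a b c m =
      ((a + b + c)! : ℚ) / (a ! * b ! * c ! * (a + b)! * (b + c)! * (c + a)!) := by
  induction a with
  | zero =>
    rw [sum_eq_single 0]
    · simp only [dixonTerm, add_zero, sub_zero, invFact_natCast]
      have := Nat.factorial_ne_zero (b + c)
      simp
      field_simp
    · intro m _ hm
      rcases lt_or_gt_of_ne hm with h | h
      · simp [dixonTerm, invFact_of_neg h]
      · simp [dixonTerm, invFact_of_neg (neg_lt_zero.2 h)]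
    · simp
  | succ a ih =>
    have hT : ∑ m ∈ Ico (-L : ℤ) (L + 1),
        (dixonCompanion a b c m - dixonCompanion a b c (m + 1)) = 0 := by
      have h1 : dixonCompanion a b c (-L) = 0 := by
        simp [dixonCompanion, invFact_of_neg (by lia : (b : ℤ) + -L - 1 < 0)]
      have h2 : dixonCompanion a b c (L + 1) = 0 := by
        simp [dixonCompanion, invFact_of_neg (by lia : (b : ℤ) - (L + 1) < 0)]
      rw [sum_sub_distrib, sum_Ico_add' (dixonCompanion a b c)]
      have h3 := sum_Ioo_add_eq_sum_Ico (f := dixonCompanion a b c) (by lia : (-L : ℤ) < L + 1)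
      have h4 : Ico (-L + 1 : ℤ) (L + 1 + 1) = insert (L + 1 : ℤ) (Ioo (-L : ℤ) (L + 1)) := by
        ext m
        simp only [mem_Ico, mem_insert, mem_Ioo]
        lia
      rw [h4, sum_insert (by simp), ← h3, h1, h2]
      ring
    simp only [← dixonTerm_succ, ← mul_sum, sum_sub_distrib] at hT
    rw [ih] at hT
    have h : ((a : ℚ) + 1) * (a + 1 + b) * (a + 1 + c) ≠ 0 := by positivity
    refine mul_left_cancel₀ h ?_
    have hT' := sub_eq_zero.1 ((mul_eq_zero.1 hT).resolve_left two_ne_zero)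
    rw [hT', show a + 1 + b + c = (a + b + c) + 1 by ring, show a + 1 + b = (a + b) + 1 by ring,
      show c + (a + 1) = (c + a) + 1 by ring]
    simp only [Nat.factorial_succ]
    push_cast
    field_simp
    ring

lemma tripleSum_mul (i j k : ℕ) :
    tripleSum i j k * ((i)! * (j)! * (k)! * ((i + j)! * (j + k)! * (k + i)!)) =
      (i + j + k)! * ((2 * i)! * (2 * j)! * (2 * k)!) := by
  have h1 : (tripleSum i j k : ℚ) = (2 * i)! * (2 * j)! * (2 * k)! *
      ∑ m ∈ Ico (-(i + j + k : ℕ) : ℤ) ((i + j + k : ℕ) + 1), dixonTerm i j k m := by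
    rw [tripleSum, Int.cast_sum, mul_sum]
    refine sum_congr rfl fun m _ => ?_
    push_cast [centralChoose_eq]
    rw [dixonTerm]
    ring
  rw [sum_dixonTerm _ _ _ _ (by lia)] at h1
  have h2 : (tripleSum i j k : ℚ) * ((i)! * (j)! * (k)! * ((i + j)! * (j + k)! * (k + i)!)) =
      (i + j + k)! * ((2 * i)! * (2 * j)! * (2 * k)!) := by
    rw [h1]
    field_simp
  exact_mod_cast h2

/-- The denominator of the factorial quotient `term f`. -/
def termDen (i j k : ℕ) : ℕ := (i ! * j ! * k !) ^ 2 * ((i + j)! * (j + k)! * (k + i)!)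

/-- The numerator of the factorial quotient `term f`. -/
def termNum (i j k : ℕ) : ℕ := (i + j + k)! ^ 2 * ((2 * i)! * (2 * j)! * (2 * k)!)

lemma term_mul_termDen (f : Fin 3 → ℕ) :
    term f * termDen (f 0) (f 1) (f 2) = termNum (f 0) (f 1) (f 2) := by
  have h1 := tripleSum_mul (f 0) (f 1) (f 2)
  have h2 := Nat.multinomial_spec univ f
  simp only [Fin.prod_univ_three, Fin.sum_univ_three] at h2
  zify at h2
  simp only [term, termDen, termNum]
  push_cast
  linear_combination (Nat.multinomial univ f : ℤ) * ((f 0)! * (f 1)! * (f 2)!) * h1 +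
    ((f 0 + f 1 + f 2)! * ((2 * f 0)! * (2 * f 1)! * (2 * f 2)!) : ℤ) * h2

/-! ### Valuation of the summands -/

lemma div_sum_le {q : ℕ} (hq : 0 < q) (i j k : ℕ) :
    2 * (i / q + j / q + k / q) + ((i + j) / q + (j + k) / q + (k + i) / q) +
        (if q ∣ i + j + k ∧ ¬(q ∣ i ∧ q ∣ j ∧ q ∣ k) then 2 else 0) ≤
      2 * ((i + j + k) / q) + (2 * i / q + 2 * j / q + 2 * k / q) := by
  have key : ∀ m x c : ℕ, (m = q * x + c) → m / q = x + c / q := by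
    rintro _ x c rfl
    rw [Nat.mul_add_div hq]
  have small : ∀ c : ℕ, c < 3 * q →
      (c < q ∧ c / q = 0) ∨ (q ≤ c ∧ c < 2 * q ∧ c / q = 1) ∨ (2 * q ≤ c ∧ c / q = 2) := by
    intro c hc
    rcases lt_or_ge c q with h | h
    · exact Or.inl ⟨h, Nat.div_eq_of_lt h⟩
    rcases lt_or_ge c (2 * q) with h' | h'
    · exact Or.inr (Or.inl ⟨h, h', Nat.div_eq_of_lt_le (by lia) (by lia)⟩)
    · exact Or.inr (Or.inr ⟨h', Nat.div_eq_of_lt_le (by lia) (by lia)⟩)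
  have hi := (Nat.div_add_mod i q).symm
  have hj := (Nat.div_add_mod j q).symm
  have hk := (Nat.div_add_mod k q).symm
  have hi' := Nat.mod_lt i hq
  have hj' := Nat.mod_lt j hq
  have hk' := Nat.mod_lt k hq
  have hdvd : (q ∣ i + j + k ∧ ¬(q ∣ i ∧ q ∣ j ∧ q ∣ k)) →
      (i % q + j % q + k % q = q ∨ i % q + j % q + k % q = 2 * q) := by
    rintro ⟨h1, h2⟩
    simp only [Nat.dvd_iff_mod_eq_zero] at h2
    have h3 : q ∣ i % q + j % q + k % q := by
      have : i + j + k = q * (i / q + j / q + k / q) + (i % q + j % q + k % q) := by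
        linear_combination hi + hj + hk
      rw [this] at h1
      exact (Nat.dvd_add_right (dvd_mul_right _ _)).1 h1
    obtain ⟨d, hd⟩ := h3
    have h4 : d ≠ 0 := by rintro rfl; lia
    have h5 : d < 3 := by
      by_contra h
      have : q * 3 ≤ q * d := Nat.mul_le_mul_left q (by lia)
      lia
    interval_cases d <;> lia
  generalize i % q = a at *
  generalize j % q = b at *
  generalize k % q = c at *
  rw [key (i + j + k) (i / q + j / q + k / q) (a + b + c) (by linear_combination hi + hj + hk),
    key (i + j) (i / q + j / q) (a + b) (by linear_combination hi + hj),
    key (j + k) (j / q + k / q) (b + c) (by linear_combination hj + hk),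
    key (k + i) (k / q + i / q) (c + a) (by linear_combination hk + hi),
    key (2 * i) (2 * (i / q)) (2 * a) (by linear_combination 2 * hi),
    key (2 * j) (2 * (j / q)) (2 * b) (by linear_combination 2 * hj),
    key (2 * k) (2 * (k / q)) (2 * c) (by linear_combination 2 * hk)]
  have s1 := small (a + b + c) (by lia)
  have s2 := small (a + b) (by lia)
  have s3 := small (b + c) (by lia)
  have s4 := small (c + a) (by lia)
  have s5 := small (2 * a) (by lia)
  have s6 := small (2 * b) (by lia)
  have s7 := small (2 * c) (by lia)
  clear key small hi hj hk
  split_ifs with h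
  · have := hdvd h
    clear hdvd
    lia
  · clear hdvd
    lia

lemma padicValNat_termDen_add_le {p : ℕ} [hp : Fact p.Prime] {i j k s R : ℕ}
    (hR : p ^ R ∣ i + j + k)
    (h : s = R ∨ ¬(p ^ (s + 1) ∣ i ∧ p ^ (s + 1) ∣ j ∧ p ^ (s + 1) ∣ k)) :
    padicValNat p (termDen i j k) + 2 * (R - s) ≤ padicValNat p (termNum i j k) := by
  obtain ⟨B, hB⟩ : ∃ B, B = Nat.log p (2 * (i + j + k)) + R + 1 := ⟨_, rfl⟩
  have hlog : ∀ m, m ≤ 2 * (i + j + k) → Nat.log p m < B := fun m hm => by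
    have := Nat.log_mono_right (b := p) hm
    lia
  have hf := Nat.factorial_ne_zero
  have hden : padicValNat p (termDen i j k) = ∑ t ∈ Ico 1 B,
      (2 * (i / p ^ t + j / p ^ t + k / p ^ t) +
        ((i + j) / p ^ t + (j + k) / p ^ t + (k + i) / p ^ t)) := by
    simp only [termDen]
    rw [padicValNat.mul (by simp [hf]) (by simp [hf]), padicValNat.pow,
      padicValNat.mul (by simp [hf]) (by simp [hf]), padicValNat.mul (by simp [hf]) (by simp [hf]),
      padicValNat.mul (by simp [hf]) (by simp [hf]), padicValNat.mul (by simp [hf]) (by simp [hf]),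
      padicValNat_factorial (hlog i (by lia)), padicValNat_factorial (hlog j (by lia)),
      padicValNat_factorial (hlog k (by lia)), padicValNat_factorial (hlog (i + j) (by lia)),
      padicValNat_factorial (hlog (j + k) (by lia)), padicValNat_factorial (hlog (k + i) (by lia))]
    simp only [sum_add_distrib, ← mul_sum]
  have hnum : padicValNat p (termNum i j k) = ∑ t ∈ Ico 1 B,
      (2 * ((i + j + k) / p ^ t) + (2 * i / p ^ t + 2 * j / p ^ t + 2 * k / p ^ t)) := by
    simp only [termNum]
    rw [padicValNat.mul (by simp [hf]) (by simp [hf]), padicValNat.pow,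
      padicValNat.mul (by simp [hf]) (by simp [hf]), padicValNat.mul (by simp [hf]) (by simp [hf]),
      padicValNat_factorial (hlog (i + j + k) (by lia)),
      padicValNat_factorial (hlog (2 * i) (by lia)), padicValNat_factorial (hlog (2 * j) (by lia)),
      padicValNat_factorial (hlog (2 * k) (by lia))]
    simp only [sum_add_distrib, ← mul_sum]
  have hextra : 2 * (R - s) ≤ ∑ t ∈ Ico 1 B,
      (if p ^ t ∣ i + j + k ∧ ¬(p ^ t ∣ i ∧ p ^ t ∣ j ∧ p ^ t ∣ k) then 2 else 0) := by
    calc 2 * (R - s) = ∑ t ∈ Ico (s + 1) (R + 1), 2 := by simp [mul_comm]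
      _ ≤ ∑ t ∈ Ico (s + 1) (R + 1),
          (if p ^ t ∣ i + j + k ∧ ¬(p ^ t ∣ i ∧ p ^ t ∣ j ∧ p ^ t ∣ k) then 2 else 0) := by
        refine sum_le_sum fun t ht => ?_
        rw [mem_Ico] at ht
        have h1 : p ^ (s + 1) ∣ p ^ t := pow_dvd_pow p ht.1
        rw [if_pos]
        refine ⟨(pow_dvd_pow p (by lia)).trans hR, fun h2 => ?_⟩
        rcases h with h | h
        · lia
        · exact h ⟨h1.trans h2.1, h1.trans h2.2.1, h1.trans h2.2.2⟩
      _ ≤ _ := sum_le_sum_of_subset (Ico_subset_Ico (by lia) (by lia))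
  rw [hden, hnum]
  refine (Nat.add_le_add_left hextra _).trans ?_
  rw [← sum_add_distrib]
  exact sum_le_sum fun t _ => div_sum_le (pow_pos hp.out.pos t) i j k

lemma termDen_ne_zero (i j k : ℕ) : termDen i j k ≠ 0 := by
  simp [termDen, Nat.factorial_ne_zero]

lemma termNum_ne_zero (i j k : ℕ) : termNum i j k ≠ 0 := by
  simp [termNum, Nat.factorial_ne_zero]

lemma pow_dvd_term {p : ℕ} (hp : p.Prime) {f : Fin 3 → ℕ} {s R : ℕ}
    (hR : p ^ R ∣ ∑ i, f i) (h : s = R ∨ ¬∀ i, p ^ (s + 1) ∣ f i) :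
    (p : ℤ) ^ (2 * (R - s)) ∣ term f := by
  have : Fact p.Prime := ⟨hp⟩
  rw [Fin.sum_univ_three] at hR
  have hall : (∀ i, p ^ (s + 1) ∣ f i) ↔
      p ^ (s + 1) ∣ f 0 ∧ p ^ (s + 1) ∣ f 1 ∧ p ^ (s + 1) ∣ f 2 := by
    simp [Fin.forall_fin_succ]
  rw [hall] at h
  have h1 := padicValNat_termDen_add_le hR h
  have h2 : (term f).natAbs * termDen (f 0) (f 1) (f 2) = termNum (f 0) (f 1) (f 2) := by
    have := congrArg Int.natAbs (term_mul_termDen f)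
    simpa [Int.natAbs_mul] using this
  have h3 : (term f).natAbs ≠ 0 := fun h0 => termNum_ne_zero (f 0) (f 1) (f 2) (by
    rw [← h2, h0, zero_mul])
  rw [← h2, padicValNat.mul h3 (termDen_ne_zero _ _ _)] at h1
  rw [← Int.dvd_natAbs]
  exact_mod_cast (padicValNat_dvd_iff_le h3).2 (by lia)

/-! ### Products of integers prime to `p` -/

/-- The product of the integers below `m` that are not divisible by `p`. -/
def unitProd (p m : ℕ) : ℕ := ∏ x ∈ range m, if p ∣ x then 1 else x

lemma factorial_mul_eq {p : ℕ} (hp : 0 < p) (m : ℕ) :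
    (p * m)! = p ^ m * m ! * unitProd p (p * m) := by
  induction m with
  | zero => simp [unitProd]
  | succ m ih =>
    obtain ⟨c, rfl⟩ : ∃ c, p = c + 1 := ⟨p - 1, by lia⟩
    set q := c + 1 with hq
    have h1 : unitProd q (q * (m + 1)) =
        unitProd q (q * m) * ∏ x ∈ range c, (q * m + x + 1) := by
      rw [unitProd, mul_add_one, prod_range_add, hq, prod_range_succ', ← hq]
      simp only [Nat.dvd_add_right (dvd_mul_right q m), dvd_zero, if_true, mul_one, unitProd]
      congr 1
      refine prod_congr rfl fun x hx => ?_
      rw [if_neg (Nat.not_dvd_of_pos_of_lt (by lia) (by simp only [mem_range] at hx; lia)), add_assoc]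
    have h2 : (q * (m + 1))! = (q * m)! * (∏ x ∈ range c, (q * m + x + 1)) * (q * (m + 1)) := by
      rw [mul_add_one, ← Nat.factorial_mul_ascFactorial, Nat.ascFactorial_eq_prod_range, hq,
        prod_range_succ, ← hq, mul_assoc]
      congr 2
      · exact prod_congr rfl fun x _ => by ring
      · lia
    rw [h2, ih, h1, Nat.factorial_succ]
    ring

lemma coprime_unitProd {p : ℕ} (hp : p.Prime) (m : ℕ) : p.Coprime (unitProd p m) := by
  refine Nat.Coprime.prod_right fun x _ => ?_
  split_ifs with h
  · simp
  · exact (hp.coprime_iff_not_dvd).2 h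

/-- Blocks of `p ^ s` consecutive integers have congruent products of the members prime to `p`. -/
lemma prod_block_modEq {p s : ℕ} (hp : p.Prime) (hp3 : 3 ≤ p) (hs : 0 < s) (a : ℕ) :
    (∏ x ∈ range (p ^ s), if p ∣ x then 1 else p ^ s * a + x) ≡ unitProd p (p ^ s)
      [MOD (p ^ s) ^ 2] := by
  set q := p ^ s with hq
  have hpq : p ∣ q := dvd_pow_self p hs.ne'
  have hq0 : 0 < q := pow_pos hp.pos s
  set U := (range q).filter (fun x => ¬p ∣ x) with hU
  have hfilter : ∀ g : ℕ → ℕ, (∏ x ∈ range q, if p ∣ x then 1 else g x) = ∏ x ∈ U, g x := by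
    intro g
    rw [hU, prod_filter]
    exact prod_congr rfl fun x _ => by split_ifs <;> simp_all
  rw [unitProd, hfilter, hfilter, ← Int.natCast_modEq_iff]
  push_cast
  have hmem : ∀ x ∈ U, 0 < x ∧ x < q ∧ q - x ∈ U := by
    intro x hx
    simp only [hU, mem_filter, mem_range] at hx ⊢
    have h0 : 0 < x := Nat.pos_of_ne_zero fun h => hx.2 (h ▸ dvd_zero p)
    refine ⟨h0, hx.1, by lia, fun h => hx.2 ?_⟩
    have := Nat.dvd_sub hpq h
    rwa [Nat.sub_sub_self hx.1.le] at this
  have hrefl : ∀ g : ℤ → ℤ, ∏ x ∈ U, g x = ∏ x ∈ U, g (q - x) := by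
    intro g
    refine prod_nbij' (fun x => q - x) (fun x => q - x) (fun x hx => (hmem x hx).2.2)
      (fun x hx => (hmem x hx).2.2) ?_ ?_ ?_
    · exact fun x hx => Nat.sub_sub_self (hmem x hx).2.1.le
    · exact fun x hx => Nat.sub_sub_self (hmem x hx).2.1.le
    · intro x hx
      rw [Nat.cast_sub (hmem x hx).2.1.le, sub_sub_cancel]
  set V : ℤ := ∏ x ∈ U, ((q : ℤ) * a + x) with hV
  set W : ℤ := ∏ x ∈ U, (x : ℤ) with hW
  have h1 : V ≡ W [ZMOD q] := by
    refine Int.ModEq.prod fun x _ => ?_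
    exact (Int.modEq_iff_dvd.2 ⟨-a, by ring⟩)
  have h2 : V * V ≡ W * W [ZMOD q ^ 2] := by
    have e1 : V * V = ∏ x ∈ U, (((q : ℤ) * a + x) * (q * a + (q - x))) := by
      rw [prod_mul_distrib, ← hrefl (fun x => (q : ℤ) * a + x)]
    have e2 : W * W = ∏ x ∈ U, ((x : ℤ) * (q - x)) := by
      rw [prod_mul_distrib, ← hrefl (fun x => x)]
    rw [e1, e2]
    refine Int.ModEq.prod fun x _ => ?_
    exact (Int.modEq_iff_dvd.2 ⟨-(a * (a + 1)), by ring⟩)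
  have hpW : ¬(p : ℤ) ∣ W + V := by
    intro h
    have h3 : (p : ℤ) ∣ W - V := (Int.natCast_dvd_natCast.2 hpq).trans h1.dvd
    have h4 : (p : ℤ) ∣ 2 * W := by
      have := dvd_add h h3
      rwa [show W + V + (W - V) = 2 * W by ring] at this
    have hpZ := Nat.prime_iff_prime_int.1 hp
    rcases hpZ.dvd_or_dvd h4 with h5 | h5
    · have := Int.le_of_dvd two_pos h5
      lia
    · obtain ⟨x, hx, hx'⟩ := (Prime.dvd_finsetProd_iff hpZ _).1 h5
      exact (mem_filter.1 hx).2 (Int.natCast_dvd_natCast.1 hx')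
  have hcop : IsCoprime ((q : ℤ) ^ 2) (W + V) := by
    have := (Nat.prime_iff_prime_int.1 hp).coprime_iff_not_dvd.2 hpW
    rw [hq]
    push_cast
    exact this.pow_left.pow_left
  rw [Int.modEq_iff_dvd]
  refine hcop.dvd_of_dvd_mul_left ?_
  have := h2.dvd
  rwa [show W * W - V * V = (W + V) * (W - V) by ring] at this

lemma unitProd_modEq {p s : ℕ} (hp : p.Prime) (hp3 : 3 ≤ p) (hs : 0 < s) (a : ℕ) :
    unitProd p (p ^ s * a) ≡ unitProd p (p ^ s) ^ a [MOD (p ^ s) ^ 2] := by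
  induction a with
  | zero => simp [unitProd, Nat.ModEq.refl]
  | succ a ih =>
    have h : unitProd p (p ^ s * (a + 1)) = unitProd p (p ^ s * a) *
        ∏ x ∈ range (p ^ s), if p ∣ x then 1 else p ^ s * a + x := by
      have : p ∣ p ^ s * a := (dvd_pow_self p hs.ne').mul_right a
      rw [unitProd, mul_add_one, prod_range_add]
      simp only [Nat.dvd_add_right this, unitProd]
    rw [h, pow_succ]
    exact ih.mul (prod_block_modEq hp hp3 hs a)

/-! ### The supercongruence -/

/-- The quotient of the denominators of `term (p • f)` and `term f`, up to a power of `p`. -/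
def denRatio (p i j k : ℕ) : ℕ :=
  (unitProd p (p * i) * unitProd p (p * j) * unitProd p (p * k)) ^ 2 *
    (unitProd p (p * (i + j)) * unitProd p (p * (j + k)) * unitProd p (p * (k + i)))

/-- The quotient of the numerators of `term (p • f)` and `term f`, up to a power of `p`. -/
def numRatio (p i j k : ℕ) : ℕ :=
  unitProd p (p * (i + j + k)) ^ 2 *
    (unitProd p (p * (2 * i)) * unitProd p (p * (2 * j)) * unitProd p (p * (2 * k)))

lemma termDen_mul {p : ℕ} (hp : 0 < p) (i j k : ℕ) :
    termDen (p * i) (p * j) (p * k) =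
      p ^ (4 * (i + j + k)) * termDen i j k * denRatio p i j k := by
  simp only [termDen, denRatio, ← mul_add, factorial_mul_eq hp]
  ring

lemma termNum_mul {p : ℕ} (hp : 0 < p) (i j k : ℕ) :
    termNum (p * i) (p * j) (p * k) =
      p ^ (4 * (i + j + k)) * termNum i j k * numRatio p i j k := by
  simp only [termNum, numRatio, ← mul_add, mul_left_comm 2 p, factorial_mul_eq hp]
  ring

lemma term_nsmul_mul {p : ℕ} (hp : 0 < p) (f : Fin 3 → ℕ) :
    term (p • f) * denRatio p (f 0) (f 1) (f 2) = term f * numRatio p (f 0) (f 1) (f 2) := by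
  have h1 := term_mul_termDen (p • f)
  have h2 := term_mul_termDen f
  simp only [Pi.smul_apply, smul_eq_mul, termDen_mul hp, termNum_mul hp] at h1
  push_cast at h1
  have h3 : ((p : ℤ) ^ (4 * (f 0 + f 1 + f 2)) * termDen (f 0) (f 1) (f 2)) ≠ 0 := by
    have := termDen_ne_zero (f 0) (f 1) (f 2)
    positivity
  refine mul_left_cancel₀ h3 ?_
  linear_combination h1 - (p : ℤ) ^ (4 * (f 0 + f 1 + f 2)) * numRatio p (f 0) (f 1) (f 2) * h2

lemma numRatio_modEq {p s i j k : ℕ} (hp : p.Prime) (hp3 : 3 ≤ p) (hi : p ^ s ∣ i) (hj : p ^ s ∣ j)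
    (hk : p ^ s ∣ k) : numRatio p i j k ≡ denRatio p i j k [MOD (p ^ (s + 1)) ^ 2] := by
  obtain ⟨i, rfl⟩ := hi
  obtain ⟨j, rfl⟩ := hj
  obtain ⟨k, rfl⟩ := hk
  have h : ∀ a, unitProd p (p * (p ^ s * a)) ≡ unitProd p (p ^ (s + 1)) ^ a
      [MOD (p ^ (s + 1)) ^ 2] := fun a => by
    rw [← mul_assoc, ← pow_succ']
    exact unitProd_modEq hp hp3 s.succ_pos a
  simp only [numRatio, denRatio, ← mul_add, mul_left_comm 2 (p ^ s)]
  refine (((h _).pow 2).mul (((h _).mul (h _)).mul (h _))).trans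
    (Nat.ModEq.trans ?_
      (((((h _).mul (h _)).mul (h _)).pow 2).mul (((h _).mul (h _)).mul (h _))).symm)
  exact congrArg (· % _) (by ring)

lemma coprime_denRatio {p : ℕ} (hp : p.Prime) (i j k : ℕ) : p.Coprime (denRatio p i j k) := by
  have h := fun m => coprime_unitProd hp (p * m)
  exact (((h i).mul_right (h j)).mul_right (h k)).pow_right 2 |>.mul_right
    (((h _).mul_right (h _)).mul_right (h _))

lemma pow_dvd_term_nsmul_sub {p : ℕ} (hp : p.Prime) (hp3 : 3 ≤ p) {f : Fin 3 → ℕ} {R : ℕ}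
    (hR : p ^ R ∣ ∑ i, f i) : (p : ℤ) ^ (2 * (R + 1)) ∣ term (p • f) - term f := by
  obtain ⟨s, hs, hall, hmax⟩ : ∃ s ≤ R, (∀ i, p ^ s ∣ f i) ∧
      (s = R ∨ ¬∀ i, p ^ (s + 1) ∣ f i) := by
    have hP : ∃ s, s = R ∨ ¬∀ i, p ^ (s + 1) ∣ f i := ⟨R, Or.inl rfl⟩
    obtain ⟨s, hs, hmin⟩ : ∃ s, (s = R ∨ ¬∀ i, p ^ (s + 1) ∣ f i) ∧
        ∀ t < s, ¬(t = R ∨ ¬∀ i, p ^ (t + 1) ∣ f i) := by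
      classical exact ⟨Nat.find hP, Nat.find_spec hP, fun _ => Nat.find_min hP⟩
    refine ⟨s, not_lt.1 fun h => hmin R h (Or.inl rfl), ?_, hs⟩
    rcases Nat.eq_zero_or_pos s with rfl | h
    · simp
    · have := hmin _ (Nat.sub_one_lt h.ne')
      rw [Nat.sub_add_cancel h] at this
      push Not at this
      exact this.2
  have h1 := pow_dvd_term hp hR hmax
  have h2 := Int.natCast_modEq_iff.2 (numRatio_modEq hp hp3 (hall 0) (hall 1) (hall 2))
  have h3 := term_nsmul_mul hp.pos f
  have h4 : IsCoprime ((p : ℤ) ^ (2 * (R + 1))) (denRatio p (f 0) (f 1) (f 2)) :=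
    (Nat.isCoprime_iff_coprime.2 (coprime_denRatio hp _ _ _)).pow_left
  refine h4.dvd_of_dvd_mul_right ?_
  have h5 := mul_dvd_mul h1 h2.symm.dvd
  push_cast at h5
  rw [← pow_mul, ← pow_add, show 2 * (R - s) + (s + 1) * 2 = 2 * (R + 1) by lia] at h5
  rwa [sub_mul, h3, ← mul_sub]

end SporadicF

theorem supercongruence_F (p : ℕ) (hp : p.Prime) (hp3 : 3 ≤ p)
    (n r : ℕ) (hn : 0 < n) (hr : 0 < r) :
    (p : ℤ) ^ (2 * r) ∣ aperyF (p ^ r * n) - aperyF (p ^ (r - 1) * n) := by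
  open SporadicF Finset in
  obtain ⟨R, rfl⟩ : ∃ R, r = R + 1 := ⟨r - 1, by lia⟩
  have hmap : {f ∈ piAntidiag (univ : Finset (Fin 3)) (p * (p ^ R * n)) | ∀ i, p ∣ f i} =
      (piAntidiag univ (p ^ R * n)).map ⟨(p • ·), nsmul_right_injective hp.ne_zero⟩ := by
    rw [map_nsmul_piAntidiag_univ _ hp.ne_zero]
    ext f
    simp
  rw [Nat.add_sub_cancel, aperyF_eq_sum_term, aperyF_eq_sum_term,
    ← sum_filter_add_sum_filter_not _ (fun f => ∀ i, p ∣ f i), pow_succ', mul_assoc,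
    hmap, sum_map, add_sub_right_comm, ← sum_sub_distrib]
  refine dvd_add (dvd_sum fun f hf => ?_) (dvd_sum fun f hf => ?_)
  · refine pow_dvd_term_nsmul_sub hp hp3 ?_
    rw [(mem_piAntidiag.1 hf).1]
    exact dvd_mul_right _ _
  · rw [mem_filter, mem_piAntidiag] at hf
    refine pow_dvd_term (s := 0) hp ?_ (Or.inr ?_)
    · rw [hf.1.1, ← mul_assoc, ← pow_succ']
      exact dvd_mul_right _ _
    · simpa using hf.2
end

section
/- Let A_\delta(n) = \sum_{k=0}^{\lfloor n/3 \rfloor} (-1)^k 3^{n-3k} \binom{n}{3k} \binom{n+k}{n} (3k)!/(k!)^3 (the Almkvist–Zudilin numbers). Then for every prime p \ge 3 and all positive integers n and r, we have A_\delta(p^r n) \equiv A_\delta(p^{r-1} n) (mod p^{2r}), i.e., p^{2r} divides A_\delta(p^r n) - A_\delta(p^{r-1} n). -/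
/-- The Almkvist–Zudilin numbers. -/
def aperyDelta (n : ℕ) : ℤ :=
  ∑ k ∈ Finset.range (n / 3 + 1),
    (-1) ^ k * 3 ^ (n - 3 * k) * (n.choose (3 * k) : ℤ) * ((n + k).choose n : ℤ) *
      (((3 * k).factorial / k.factorial ^ 3 : ℕ) : ℤ)

open Finset

/-- `a / b` is a quotient `X / Y` with `Y` prime to `p` and `X ≡ Y` modulo `Q`, written without
division so that `b = 0` is allowed. -/
def UnitClose (p : ℕ) (Q a b : ℤ) : Prop :=
  ∃ X Y : ℤ, ¬ (p : ℤ) ∣ Y ∧ Q ∣ X - Y ∧ Y * a = X * b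

lemma UnitClose.refl {p : ℕ} (hp : p.Prime) (Q a : ℤ) : UnitClose p Q a a :=
  ⟨1, 1, fun h => hp.one_lt.ne' (by exact_mod_cast Int.eq_one_of_dvd_one (by positivity) h),
    by simp, rfl⟩

lemma UnitClose.mul {p : ℕ} (hp : p.Prime) {Q a b c d : ℤ} (h₁ : UnitClose p Q a b)
    (h₂ : UnitClose p Q c d) : UnitClose p Q (a * c) (b * d) := by
  obtain ⟨X, Y, hY, hXY, h⟩ := h₁
  obtain ⟨Z, W, hW, hZW, h'⟩ := h₂
  refine ⟨X * Z, Y * W, fun hd => ?_, ?_, ?_⟩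
  · exact (Int.Prime.dvd_mul' hp hd).elim hY hW
  · have : X * Z - Y * W = (X - Y) * Z + Y * (Z - W) := by ring
    rw [this]
    exact dvd_add (hXY.mul_right _) (hZW.mul_left _)
  · linear_combination c * W * h + X * b * h'

lemma UnitClose.prod {p : ℕ} (hp : p.Prime) {Q : ℤ} {ι : Type*} (s : Finset ι) {a b : ι → ℤ}
    (h : ∀ i ∈ s, UnitClose p Q (a i) (b i)) : UnitClose p Q (∏ i ∈ s, a i) (∏ i ∈ s, b i) := by
  classical
  induction s using Finset.induction_on with
  | empty => simpa using UnitClose.refl hp Q 1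
  | insert i s hi ih =>
    rw [Finset.prod_insert hi, Finset.prod_insert hi]
    exact (h i (by simp)).mul hp (ih fun j hj => h j (by simp [hj]))

lemma UnitClose.pow_dvd_sub {p : ℕ} (hp : p.Prime) {k l : ℕ} {a b : ℤ}
    (h : UnitClose p ((p : ℤ) ^ k) a b) (hb : (p : ℤ) ^ l ∣ b) :
    (p : ℤ) ^ (k + l) ∣ a - b := by
  obtain ⟨X, Y, hY, hXY, h⟩ := h
  have hc : IsCoprime ((p : ℤ) ^ (k + l)) Y :=
    ((Nat.prime_iff_prime_int.mp hp).coprime_iff_not_dvd.mpr hY).pow_left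
  refine hc.dvd_of_dvd_mul_left (z := a - b) ?_
  have : Y * (a - b) = (X - Y) * b := by linear_combination h
  rw [this, pow_add]
  exact mul_dvd_mul hXY hb

/-- The product of the positive integers up to `p * n` that are not divisible by `p`. -/
def coprimeFactorial (p n : ℕ) : ℕ := ∏ b ∈ range n, ∏ k ∈ range (p - 1), (p * b + k + 1)

lemma factorial_prime_mul {p : ℕ} (hp : 0 < p) (n : ℕ) :
    (p * n).factorial = p ^ n * n.factorial * coprimeFactorial p n := by
  induction n with
  | zero => simp [coprimeFactorial]
  | succ n ih =>
    have h : (p * (n + 1)).factorial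
        = (p * n).factorial * ∏ k ∈ range p, (p * n + k + 1) := by
      rw [mul_add, mul_one, ← prod_range_add_one_eq_factorial, prod_range_add,
        prod_range_add_one_eq_factorial]
    obtain ⟨q, rfl⟩ : ∃ q, p = q + 1 := ⟨p - 1, by omega⟩
    rw [h, ih, prod_range_succ, coprimeFactorial, coprimeFactorial, prod_range_succ,
      Nat.factorial_succ, Nat.add_sub_cancel]
    ring

lemma coprimeFactorial_ne_zero (p n : ℕ) : coprimeFactorial p n ≠ 0 :=
  prod_ne_zero_iff.mpr fun _ _ => prod_ne_zero_iff.mpr fun _ _ => by omega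

lemma choose_prime_mul {p : ℕ} (hp : 0 < p) (D B : ℕ) :
    coprimeFactorial p B * (p * (D + B)).choose (p * B) =
      (∏ b ∈ range B, ∏ k ∈ range (p - 1), (p * D + (p * b + k + 1))) * (D + B).choose B := by
  have h1 := Nat.add_choose_mul_factorial_mul_factorial (p * D) (p * B)
  have h2 := Nat.add_choose_mul_factorial_mul_factorial D B
  rw [← mul_add, factorial_prime_mul hp, factorial_prime_mul hp, factorial_prime_mul hp] at h1
  have h3 : coprimeFactorial p (D + B) = coprimeFactorial p D *
      ∏ b ∈ range B, ∏ k ∈ range (p - 1), (p * D + (p * b + k + 1)) := by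
    rw [coprimeFactorial, prod_range_add, coprimeFactorial]
    simp only [mul_add, add_assoc]
  rw [h3, ← h2] at h1
  have hpos : 0 < p ^ (D + B) * D.factorial * B.factorial * coprimeFactorial p D :=
    Nat.pos_of_ne_zero (by
      have := coprimeFactorial_ne_zero p D
      positivity)
  apply Nat.eq_of_mul_eq_mul_left hpos
  linear_combination h1

lemma unitClose_choose {p : ℕ} (hp : p.Prime) (hp3 : 3 ≤ p) {s A B : ℕ} (hA : p ^ s ∣ A)
    (hB : p ^ s ∣ B) :
    UnitClose p ((p : ℤ) ^ (2 * (s + 1))) ((p * A).choose (p * B)) (A.choose B) := by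
  rcases lt_or_ge A B with h | h
  · rw [Nat.choose_eq_zero_of_lt h,
      Nat.choose_eq_zero_of_lt (Nat.mul_lt_mul_of_pos_left h hp.pos)]
    exact UnitClose.refl hp _ _
  obtain ⟨D, rfl⟩ : ∃ D, A = D + B := ⟨A - B, by omega⟩
  have hD : p ^ s ∣ D := (Nat.dvd_add_left hB).mp hA
  have hp' := Nat.prime_iff_prime_int.mp hp
  set X : ℤ := ∏ b ∈ range B, ∏ k ∈ range (p - 1), ((p * D : ℤ) + (p * b + k + 1)) with hX
  set Y : ℤ := ∏ b ∈ range B, ∏ k ∈ range (p - 1), ((p * b + k + 1 : ℤ)) with hY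
  have hYp : ¬ (p : ℤ) ∣ Y := by
    rw [hY, hp'.dvd_finsetProd_iff]
    rintro ⟨b, -, hb⟩
    rw [hp'.dvd_finsetProd_iff] at hb
    obtain ⟨k, hk, hb⟩ := hb
    rw [add_assoc, Int.dvd_add_right (dvd_mul_right _ _)] at hb
    have := Nat.le_of_dvd (by omega) (show p ∣ k + 1 by exact_mod_cast hb)
    have := mem_range.mp hk
    omega
  have hXYp : (p : ℤ) ∣ X - Y := by
    refine (Int.ModEq.prod fun b _ => Int.ModEq.prod fun k _ => ?_ : Y ≡ X [ZMOD p]).dvd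
    exact (Int.modEq_iff_dvd.mpr ⟨D, by ring⟩)
  have hrefl : ∀ c : ℤ, (∏ b ∈ range B, ∏ k ∈ range (p - 1), (c + (p * b + k + 1))) =
      ∏ b ∈ range B, ∏ k ∈ range (p - 1), (c + (p * B - (p * b + k + 1))) := by
    intro c
    rw [← prod_range_reflect]
    refine prod_congr rfl fun b hb => ?_
    rw [← prod_range_reflect]
    refine prod_congr rfl fun k hk => ?_
    have := mem_range.mp hb
    have := mem_range.mp hk
    rw [Nat.sub_sub, Nat.sub_sub, Nat.cast_sub (by omega), Nat.cast_sub (by omega),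
      Nat.cast_sub (by omega)]
    push_cast
    ring
  have hsq : (p : ℤ) ^ (2 * (s + 1)) ∣ X * X - Y * Y := by
    have hX2 : X * X = ∏ b ∈ range B, ∏ k ∈ range (p - 1),
        (((p * D : ℤ) + (p * b + k + 1)) * (p * D + (p * B - (p * b + k + 1)))) := by
      simp only [prod_mul_distrib]
      rw [← hrefl]
    have hY2 : Y * Y = ∏ b ∈ range B, ∏ k ∈ range (p - 1),
        (((p * b + k + 1 : ℤ)) * (p * B - (p * b + k + 1))) := by
      simp only [prod_mul_distrib]
      have := hrefl 0
      simp only [zero_add] at this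
      rw [← this]
    rw [hX2, hY2]
    refine (Int.ModEq.prod fun b _ => Int.ModEq.prod fun k _ => ?_ :
      _ ≡ _ [ZMOD (p : ℤ) ^ (2 * (s + 1))]).dvd
    rw [Int.modEq_iff_dvd]
    obtain ⟨D', rfl⟩ := hD
    obtain ⟨B', rfl⟩ := hB
    refine ⟨D' * (D' + B'), ?_⟩
    push_cast
    ring
  refine ⟨X, Y, hYp, ?_, ?_⟩
  · have hc : IsCoprime ((p : ℤ) ^ (2 * (s + 1))) (X + Y) := by
      refine (hp'.coprime_iff_not_dvd.mpr fun hd => ?_).pow_left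
      have h2 : (p : ℤ) ∣ 2 * Y := by
        rw [show 2 * Y = X + Y - (X - Y) by ring]
        exact dvd_sub hd hXYp
      rcases Int.Prime.dvd_mul' hp h2 with h2 | h2
      · have := Int.le_of_dvd (by norm_num) h2
        omega
      · exact hYp h2
    exact hc.dvd_of_dvd_mul_left (by rwa [show (X + Y) * (X - Y) = X * X - Y * Y by ring])
  · have := choose_prime_mul hp.pos D B
    rw [coprimeFactorial] at this
    rw [hX, hY]
    exact_mod_cast this

lemma dvd_mul_choose (n k : ℕ) : n ∣ k * n.choose k := by
  rcases n with _ | n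
  · rcases k with _ | k <;> simp
  rcases k with _ | k
  · simp
  exact ⟨n.choose k, by rw [Nat.add_one_mul_choose_eq, mul_comm]⟩

lemma dvd_sub_mul_choose (n k : ℕ) : n ∣ (n - k) * n.choose k := by
  rcases n with _ | n
  · simp
  exact ⟨n.choose k, by rw [mul_comm, ← Nat.choose_mul_succ_eq, mul_comm]⟩

lemma pow_sub_dvd_of_dvd_mul {p : ℕ} (hp : p.Prime) {e s a x : ℕ} (h : p ^ e ∣ a * x)
    (ha : ¬ p ^ (s + 1) ∣ a) : p ^ (e - s) ∣ x := by
  have ha0 : a ≠ 0 := by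
    rintro rfl
    simp at ha
  obtain ⟨t, b, hb, rfl⟩ := Nat.exists_eq_pow_mul_and_not_dvd ha0 p hp.ne_one
  have hts : t ≤ s := by
    by_contra hlt
    exact ha ((pow_dvd_pow p (by omega)).mul_right b)
  rcases le_total e t with het | het
  · rw [Nat.sub_eq_zero_of_le (het.trans hts)]
    simp
  rw [← Nat.add_sub_cancel' het, pow_add, mul_assoc] at h
  have h' := Nat.dvd_of_mul_dvd_mul_left (pow_pos hp.pos t) h
  have hc : Nat.Coprime (p ^ (e - t)) b :=
    Nat.Coprime.pow_left _ ((Nat.Prime.coprime_iff_not_dvd hp).mpr hb)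
  exact (pow_dvd_pow p (by omega)).trans (hc.dvd_of_dvd_mul_left h')

/-- The weight of `v = (j, f, g)`: the square of `N.choose j` times a product over `t` of trinomial
coefficients of `N - j` with parts `f t` and `g t`. -/
def deltaTerm (N : ℕ) (v : ℕ × (Fin 3 → ℕ) × (Fin 3 → ℕ)) : ℕ :=
  N.choose v.1 ^ 2 *
    ∏ t, (N - v.1).choose (v.2.1 t) * (N - v.1 - v.2.1 t).choose (v.2.2 t)

/-- The triples `(j, f, g)` with `j ≤ N` and both `f` and `g` summing to `N`. -/
def deltaIndex (N : ℕ) : Finset (ℕ × (Fin 3 → ℕ) × (Fin 3 → ℕ)) :=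
  range (N + 1) ×ˢ finAntidiagonal 3 N ×ˢ finAntidiagonal 3 N

lemma mem_deltaIndex {N : ℕ} {v : ℕ × (Fin 3 → ℕ) × (Fin 3 → ℕ)} :
    v ∈ deltaIndex N ↔ v.1 ≤ N ∧ ∑ t, v.2.1 t = N ∧ ∑ t, v.2.2 t = N := by
  simp [deltaIndex]

/-- Every component of the index is divisible by `q`. -/
def AllDvd (q : ℕ) (v : ℕ × (Fin 3 → ℕ) × (Fin 3 → ℕ)) : Prop :=
  q ∣ v.1 ∧ (∀ t, q ∣ v.2.1 t) ∧ ∀ t, q ∣ v.2.2 t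

lemma exists_ne_not_dvd_of_dvd_sum {ι : Type*} [Fintype ι] {q : ℕ} {g : ι → ℕ}
    (h : q ∣ ∑ t, g t) {t : ι} (ht : ¬ q ∣ g t) : ∃ t', t ≠ t' ∧ ¬ q ∣ g t' := by
  classical
  by_contra! hc
  rw [← add_sum_erase univ g (mem_univ t)] at h
  exact ht ((Nat.dvd_add_left (dvd_sum fun i hi => hc i (ne_of_mem_erase hi).symm)).mp h)

lemma pow_dvd_deltaTerm {p : ℕ} (hp : p.Prime) {N e s : ℕ} (hN : p ^ e ∣ N)
    {v : ℕ × (Fin 3 → ℕ) × (Fin 3 → ℕ)} (hv : v ∈ deltaIndex N)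
    (h : s < e → ¬ AllDvd (p ^ (s + 1)) v) : p ^ (2 * (e - s)) ∣ deltaTerm N v := by
  rcases le_or_gt e s with hes | hse
  · simp [Nat.sub_eq_zero_of_le hes]
  obtain ⟨j, f, g⟩ := v
  obtain ⟨-, hf, hg⟩ := mem_deltaIndex.mp hv
  simp only at hf hg
  have hsN : p ^ (s + 1) ∣ N := (pow_dvd_pow p hse).trans hN
  simp only [deltaTerm]
  set c : Fin 3 → ℕ := fun t => (N - j).choose (f t) * (N - j - f t).choose (g t) with hc
  have key : ∀ i t, (N - j) ∣ i * c t → ¬ p ^ (s + 1) ∣ i →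
      p ^ (e - s) ∣ N.choose j * c t := by
    intro i t hd hi
    refine pow_sub_dvd_of_dvd_mul hp (a := i) ?_ hi
    calc p ^ e ∣ N := hN
      _ ∣ (N - j) * N.choose j := dvd_sub_mul_choose N j
      _ ∣ (i * c t) * N.choose j := Nat.mul_dvd_mul_right hd _
      _ = i * (N.choose j * c t) := by ring
  have two : ∀ t t', t ≠ t' → p ^ (e - s) ∣ N.choose j * c t →
      p ^ (e - s) ∣ N.choose j * c t' → p ^ (2 * (e - s)) ∣ N.choose j ^ 2 * ∏ t, c t := by
    intro t t' hne h1 h2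
    have : c t * c t' ∣ ∏ t, c t := by
      rw [← prod_pair hne]
      exact prod_dvd_prod_of_subset _ _ _ (subset_univ _)
    calc p ^ (2 * (e - s)) = p ^ (e - s) * p ^ (e - s) := by ring
      _ ∣ (N.choose j * c t) * (N.choose j * c t') := mul_dvd_mul h1 h2
      _ = N.choose j ^ 2 * (c t * c t') := by ring
      _ ∣ _ := Nat.mul_dvd_mul_left _ this
  by_cases hj : p ^ (s + 1) ∣ j
  · by_cases hf' : ∀ t, p ^ (s + 1) ∣ f t
    · have hg' : ¬ ∀ t, p ^ (s + 1) ∣ g t := fun hg' => h hse ⟨hj, hf', hg'⟩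
      push Not at hg'
      obtain ⟨t, ht⟩ := hg'
      obtain ⟨t', hne, ht'⟩ := exists_ne_not_dvd_of_dvd_sum (hg ▸ hsN) ht
      have hd : ∀ t, (N - j) ∣ g t * c t := fun t => by
        calc (N - j) ∣ (N - j - f t) * (N - j).choose (f t) := dvd_sub_mul_choose _ _
          _ ∣ (g t * (N - j - f t).choose (g t)) * (N - j).choose (f t) :=
            Nat.mul_dvd_mul_right (dvd_mul_choose _ _) _
          _ = g t * c t := by simp only [hc]; ring
      exact two t t' hne (key _ t (hd t) ht) (key _ t' (hd t') ht')
    · push Not at hf'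
      obtain ⟨t, ht⟩ := hf'
      obtain ⟨t', hne, ht'⟩ := exists_ne_not_dvd_of_dvd_sum (hf ▸ hsN) ht
      have hd : ∀ t, (N - j) ∣ f t * c t := fun t => by
        simp only [hc, ← mul_assoc]
        exact (dvd_mul_choose _ _).mul_right _
      exact two t t' hne (key _ t (hd t) ht) (key _ t' (hd t') ht')
  · have : p ^ (e - s) ∣ N.choose j :=
      pow_sub_dvd_of_dvd_mul hp (hN.trans (dvd_mul_choose N j)) hj
    rw [mul_comm 2, pow_mul]
    exact (pow_dvd_pow_of_dvd this 2).mul_right _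

/-- Multiplication of every component of the index by `p`. -/
def scaleIndex (p : ℕ) (v : ℕ × (Fin 3 → ℕ) × (Fin 3 → ℕ)) : ℕ × (Fin 3 → ℕ) × (Fin 3 → ℕ) :=
  (p * v.1, fun t => p * v.2.1 t, fun t => p * v.2.2 t)

lemma unitClose_deltaTerm {p : ℕ} (hp : p.Prime) (hp3 : 3 ≤ p) {N s : ℕ} (hN : p ^ s ∣ N)
    {v : ℕ × (Fin 3 → ℕ) × (Fin 3 → ℕ)} (h : AllDvd (p ^ s) v) :
    UnitClose p ((p : ℤ) ^ (2 * (s + 1))) (deltaTerm (p * N) (scaleIndex p v))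
      (deltaTerm N v) := by
  obtain ⟨j, f, g⟩ := v
  obtain ⟨hj, hf, hg⟩ := h
  simp only [deltaTerm, scaleIndex, ← Nat.mul_sub, Nat.cast_mul, Nat.cast_prod,
    pow_two]
  have hj' := unitClose_choose hp hp3 hN hj
  have hM : p ^ s ∣ N - j := Nat.dvd_sub hN hj
  exact (hj'.mul hp hj').mul hp (UnitClose.prod hp _ fun t _ =>
    (unitClose_choose hp hp3 hM (hf t)).mul hp
      (unitClose_choose hp hp3 (Nat.dvd_sub hM (hf t)) (hg t)))

lemma pow_dvd_deltaTerm_sub {p : ℕ} (hp : p.Prime) (hp3 : 3 ≤ p) {N e : ℕ} (hN : p ^ e ∣ N)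
    {v : ℕ × (Fin 3 → ℕ) × (Fin 3 → ℕ)} (hv : v ∈ deltaIndex N) :
    (p : ℤ) ^ (2 * (e + 1)) ∣ (deltaTerm (p * N) (scaleIndex p v) : ℤ) - deltaTerm N v := by
  classical
  set s := Nat.findGreatest (fun s => AllDvd (p ^ s) v) e with hs
  have hse : s ≤ e := Nat.findGreatest_le e
  have hdvd : AllDvd (p ^ s) v :=
    Nat.findGreatest_spec (P := fun s => AllDvd (p ^ s) v) (Nat.zero_le e) (by simp [AllDvd])
  have hnot : s < e → ¬ AllDvd (p ^ (s + 1)) v := fun hlt =>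
    Nat.findGreatest_is_greatest (P := fun s => AllDvd (p ^ s) v) (Nat.lt_succ_self s) hlt
  have h1 := unitClose_deltaTerm hp hp3 ((pow_dvd_pow p hse).trans hN) hdvd
  have h2 : (p : ℤ) ^ (2 * (e - s)) ∣ (deltaTerm N v : ℤ) := by
    exact_mod_cast pow_dvd_deltaTerm hp hN hv hnot
  have h3 := h1.pow_dvd_sub hp h2
  rwa [show 2 * (s + 1) + 2 * (e - s) = 2 * (e + 1) by omega] at h3

/-- The exponent, modulo 3, of the cube root of unity by which the term with index `v` is twisted. -/
def twist (v : ℕ × (Fin 3 → ℕ) × (Fin 3 → ℕ)) : ℕ :=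
  v.2.1 1 + 2 * v.2.2 1 + 2 * v.2.1 2 + v.2.2 2

lemma sum_deltaIndex_prime_mul {p : ℕ} (hp : p.Prime) {N e : ℕ} (hN : p ^ e ∣ N)
    (τ : ℕ × (Fin 3 → ℕ) × (Fin 3 → ℕ) → ℤ) :
    (p : ℤ) ^ (2 * (e + 1)) ∣ ∑ v ∈ deltaIndex (p * N), deltaTerm (p * N) v * τ v -
      ∑ v ∈ deltaIndex N, deltaTerm (p * N) (scaleIndex p v) * τ (scaleIndex p v) := by
  classical
  have hinj : Function.Injective (scaleIndex p) := by
    rintro ⟨j, f, g⟩ ⟨j', f', g'⟩ h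
    simp only [scaleIndex, Prod.mk.injEq, funext_iff, Nat.mul_right_inj hp.ne_zero] at h
    simp only [Prod.mk.injEq, funext_iff]
    exact h
  have hmem : ∀ w, scaleIndex p w ∈ deltaIndex (p * N) ↔ w ∈ deltaIndex N := by
    intro w
    simp only [mem_deltaIndex, scaleIndex, ← mul_sum, Nat.mul_right_inj hp.ne_zero,
      Nat.mul_le_mul_left_iff hp.pos]
  rw [← sum_image (s := deltaIndex N) (g := scaleIndex p)
    (f := fun v => (deltaTerm (p * N) v : ℤ) * τ v) hinj.injOn]
  have hsub : (deltaIndex N).image (scaleIndex p) ⊆ deltaIndex (p * N) := by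
    intro v hv
    obtain ⟨w, hw, rfl⟩ := mem_image.mp hv
    exact (hmem w).mpr hw
  rw [← sum_sdiff hsub, add_sub_cancel_right]
  refine dvd_sum fun v hv => ?_
  obtain ⟨hv, hv'⟩ := mem_sdiff.mp hv
  refine Dvd.dvd.mul_right ?_ _
  have := pow_dvd_deltaTerm hp (s := 0) (e := e + 1) (N := p * N)
    (by rw [pow_succ']; exact Nat.mul_dvd_mul_left p hN) hv (fun _ hall => ?_)
  · exact_mod_cast this
  · rw [zero_add, pow_one] at hall
    obtain ⟨j, f, g⟩ := v
    obtain ⟨⟨j, rfl⟩, hf, hg⟩ := hall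
    choose f' hf' using hf
    choose g' hg' using hg
    have hw : scaleIndex p (j, f', g') = (p * j, f, g) := by
      simp [scaleIndex, ← hf', ← hg']
    exact hv' (mem_image.mpr ⟨(j, f', g'), (hmem _).mp (hw ▸ hv), hw⟩)

/-- The trace of `ω ^ d`, `ω` a primitive cube root of unity. -/
def cubeTrace (d : ℕ) : ℤ := if 3 ∣ d then 2 else -1

lemma cubeTrace_prime_mul {p : ℕ} (hp : p.Prime) (hp3 : p ≠ 3) (d : ℕ) :
    cubeTrace (p * d) = cubeTrace d := by
  have : ¬ 3 ∣ p := fun h => hp3 ((Nat.prime_dvd_prime_iff_eq Nat.prime_three hp).mp h).symm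
  simp [cubeTrace, Nat.prime_three.dvd_mul, this]

lemma twist_scaleIndex (p : ℕ) (v : ℕ × (Fin 3 → ℕ) × (Fin 3 → ℕ)) :
    twist (scaleIndex p v) = p * twist v := by
  simp only [twist, scaleIndex]
  ring

/-- The cyclic permutation of the three coordinates of both vectors. -/
def rotateIndex : (ℕ × (Fin 3 → ℕ) × (Fin 3 → ℕ)) ≃ (ℕ × (Fin 3 → ℕ) × (Fin 3 → ℕ)) :=
  (Equiv.refl ℕ).prodCongr
    (((finRotate 3).arrowCongr (Equiv.refl ℕ)).prodCongr
      ((finRotate 3).arrowCongr (Equiv.refl ℕ)))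

lemma rotateIndex_apply (j : ℕ) (f g : Fin 3 → ℕ) :
    rotateIndex (j, f, g) = (j, f ∘ (finRotate 3).symm, g ∘ (finRotate 3).symm) := rfl

lemma rotateIndex_mem {N : ℕ} {v : ℕ × (Fin 3 → ℕ) × (Fin 3 → ℕ)} :
    rotateIndex v ∈ deltaIndex N ↔ v ∈ deltaIndex N := by
  obtain ⟨j, f, g⟩ := v
  simp only [rotateIndex_apply, mem_deltaIndex, Function.comp_apply]
  rw [Equiv.sum_comp (finRotate 3).symm f, Equiv.sum_comp (finRotate 3).symm g]

lemma deltaTerm_rotateIndex (N : ℕ) (v : ℕ × (Fin 3 → ℕ) × (Fin 3 → ℕ)) :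
    deltaTerm N (rotateIndex v) = deltaTerm N v := by
  obtain ⟨j, f, g⟩ := v
  simp only [rotateIndex_apply, deltaTerm, Function.comp_apply]
  rw [Equiv.prod_comp (finRotate 3).symm
    (fun t => (N - j).choose (f t) * (N - j - f t).choose (g t))]

lemma three_dvd_twist_rotateIndex {N : ℕ} {v : ℕ × (Fin 3 → ℕ) × (Fin 3 → ℕ)}
    (hv : v ∈ deltaIndex N) : 3 ∣ twist (rotateIndex v) ↔ 3 ∣ twist v := by
  obtain ⟨j, f, g⟩ := v
  obtain ⟨-, hf, hg⟩ := mem_deltaIndex.mp hv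
  simp only [Fin.sum_univ_three] at hf hg
  have h1 : (finRotate 3).symm 1 = 0 := by decide
  have h2 : (finRotate 3).symm 2 = 1 := by decide
  simp only [rotateIndex_apply, twist, Function.comp_apply, h1, h2]
  omega

lemma existsUnique_three_dvd {x y z : ℕ} (h : 3 ∣ x + y + z) (h' : ¬ 3 ∣ y + 2 * z) :
    (3 ∣ x ∧ ¬ 3 ∣ y ∧ ¬ 3 ∣ z) ∨ (¬ 3 ∣ x ∧ 3 ∣ y ∧ ¬ 3 ∣ z) ∨ (¬ 3 ∣ x ∧ ¬ 3 ∣ y ∧ 3 ∣ z) := by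
  obtain hy | hy | hy : y % 3 = 0 ∨ y % 3 = 1 ∨ y % 3 = 2 := by omega
  all_goals obtain hz | hz | hz : z % 3 = 0 ∨ z % 3 = 1 ∨ z % 3 = 2 := by omega
  all_goals omega

lemma three_pow_dvd_sum_twist {N e : ℕ} (he : 3 ^ e ∣ N) :
    (3 : ℤ) ^ (2 * e + 1) ∣
      ∑ v ∈ deltaIndex N with ¬ 3 ∣ twist v, (deltaTerm N v : ℤ) := by
  set S := (deltaIndex N).filter fun v => ¬ 3 ∣ twist v with hS
  set φ : Fin 3 → ℤ := fun t =>
    ∑ v ∈ S, if 3 ∣ v.2.1 t + 2 * v.2.2 t then (deltaTerm N v : ℤ) else 0 with hφ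
  have hrot : ∀ t, φ ((finRotate 3).symm t) = φ t := by
    intro t
    refine sum_equiv rotateIndex (fun v => ?_) fun v _ => ?_
    · simp only [hS, mem_filter, rotateIndex_mem]
      exact and_congr_right fun hv => (three_dvd_twist_rotateIndex hv).not.symm
    · rw [deltaTerm_rotateIndex]
      rfl
  have h0 : φ 2 = φ 0 := hrot 0
  have h1 : φ 0 = φ 1 := hrot 1
  have hsum : ∑ v ∈ S, (deltaTerm N v : ℤ) = 3 * φ 0 := by
    have : ∑ v ∈ S, (deltaTerm N v : ℤ) = φ 0 + φ 1 + φ 2 := by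
      simp only [hφ, ← sum_add_distrib]
      refine sum_congr rfl fun v hv => ?_
      obtain ⟨hv, hv'⟩ := mem_filter.mp hv
      obtain ⟨-, hf, hg⟩ := mem_deltaIndex.mp hv
      simp only [Fin.sum_univ_three, twist] at hf hg hv'
      rcases existsUnique_three_dvd (x := v.2.1 0 + 2 * v.2.2 0) (y := v.2.1 1 + 2 * v.2.2 1)
        (z := v.2.1 2 + 2 * v.2.2 2) (by omega) (by omega) with
        ⟨h0, h1, h2⟩ | ⟨h0, h1, h2⟩ | ⟨h0, h1, h2⟩ <;> simp [h0, h1, h2]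
    rw [this, ← h1, h0]
    ring
  rw [hsum, pow_succ']
  refine mul_dvd_mul_left 3 (dvd_sum fun v hv => ?_)
  obtain ⟨hv, hv'⟩ := mem_filter.mp hv
  split_ifs
  · have := pow_dvd_deltaTerm Nat.prime_three (s := 0) he hv fun _ ⟨_, hf, hg⟩ => hv' ?_
    · exact_mod_cast this
    · simp only [zero_add, pow_one] at hf hg
      have := hf 1
      have := hf 2
      have := hg 1
      have := hg 2
      simp only [twist]
      omega
  · exact dvd_zero _

/-- The sum of all weights, twisted by traces of cube roots of unity; it equals
`2 * (-1) ^ N * aperyDelta N`. -/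
def deltaSum (N : ℕ) : ℤ := ∑ v ∈ deltaIndex N, deltaTerm N v * cubeTrace (twist v)

lemma pow_dvd_deltaSum_sub {p : ℕ} (hp : p.Prime) (hp3 : 3 ≤ p) {N e : ℕ} (hN : p ^ e ∣ N) :
    (p : ℤ) ^ (2 * (e + 1)) ∣ deltaSum (p * N) - deltaSum N := by
  have h1 := sum_deltaIndex_prime_mul hp hN fun v => cubeTrace (twist v)
  have h2 : (p : ℤ) ^ (2 * (e + 1)) ∣
      ∑ v ∈ deltaIndex N, ((deltaTerm (p * N) (scaleIndex p v) : ℤ) - deltaTerm N v) *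
        cubeTrace (twist (scaleIndex p v)) :=
    dvd_sum fun v hv => (pow_dvd_deltaTerm_sub hp hp3 hN hv).mul_right _
  have h3 : (p : ℤ) ^ (2 * (e + 1)) ∣ ∑ v ∈ deltaIndex N, (deltaTerm N v : ℤ) *
      (cubeTrace (twist (scaleIndex p v)) - cubeTrace (twist v)) := by
    simp only [twist_scaleIndex]
    by_cases h : p = 3
    · subst h
      have : ∀ v, (deltaTerm N v : ℤ) * (cubeTrace (3 * twist v) - cubeTrace (twist v)) =
          3 * if ¬ 3 ∣ twist v then (deltaTerm N v : ℤ) else 0 := by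
        intro v
        simp only [cubeTrace, dvd_mul_right, if_true]
        split_ifs <;> first | contradiction | ring
      simp only [this, ← mul_sum, ← sum_filter]
      rw [show 2 * (e + 1) = 2 * e + 1 + 1 by ring, pow_succ']
      exact mul_dvd_mul_left _ (three_pow_dvd_sum_twist hN)
    · simp [cubeTrace_prime_mul hp h]
  have h4 := dvd_add (dvd_add h1 h2) h3
  simp only [sub_mul, mul_sub, sum_sub_distrib] at h4
  rw [deltaSum, deltaSum]
  exact h4.trans (dvd_of_eq (by ring))

open PowerSeries in
lemma coeff_C_add_C_mul_X_pow_pow {R : Type*} [CommRing R] (u v : R) {d : ℕ} (hd : 0 < d)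
    (M f : ℕ) : coeff f ((C u + C v * (X : R⟦X⟧) ^ d) ^ M) =
      if d ∣ f then M.choose (f / d) * v ^ (f / d) * u ^ (M - f / d) else 0 := by
  have h : ∀ m, coeff f ((C v * (X : R⟦X⟧) ^ d) ^ m * C u ^ (M - m) * (M.choose m : R⟦X⟧)) =
      if f = d * m then M.choose m * v ^ m * u ^ (M - m) else 0 := by
    intro m
    have : (C v * (X : R⟦X⟧) ^ d) ^ m * C u ^ (M - m) * (M.choose m : R⟦X⟧) =
        C (M.choose m * v ^ m * u ^ (M - m)) * X ^ (d * m) := by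
      simp only [map_mul, map_pow, map_natCast, mul_pow, pow_mul]
      ring
    rw [this, coeff_C_mul, coeff_X_pow]
    split_ifs <;> simp
  rw [add_comm, add_pow, map_sum, sum_congr rfl fun m _ => h m]
  split_ifs with hf
  · obtain ⟨k, rfl⟩ := hf
    simp only [Nat.mul_right_inj hd.ne', Nat.mul_div_cancel_left k hd, sum_ite_eq, mem_range]
    split_ifs with hk
    · rfl
    · rw [Nat.choose_eq_zero_of_lt (by omega)]
      simp
  · exact sum_eq_zero fun m _ => if_neg fun h => hf ⟨m, h⟩

open PowerSeries in
lemma coeff_coeff_linear_pow {R : Type*} [CommRing R] (α β : R) (M f g : ℕ) :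
    coeff g (coeff f ((C (1 + C β * (X : R⟦X⟧)) + C (C α) * X) ^ M)) =
      M.choose f * (M - f).choose g * α ^ f * β ^ g := by
  have h1 := coeff_C_add_C_mul_X_pow_pow (1 + C β * (X : R⟦X⟧)) (C α) one_pos M f
  have h2 := coeff_C_add_C_mul_X_pow_pow (1 : R) β one_pos (M - f) g
  simp only [pow_one, map_one, one_dvd, if_true, Nat.div_one, one_pow, mul_one] at h1 h2
  rw [h1, ← map_natCast (C (R := R)), ← map_pow, mul_assoc, coeff_C_mul, coeff_C_mul, h2]
  ring

open PowerSeries in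
lemma coeff_coeff_cubic_pow {R : Type*} [CommRing R] (L f g : ℕ) :
    coeff g (coeff f ((C (1 + (X : R⟦X⟧) ^ 3) + X ^ 3) ^ L)) =
      if 3 ∣ f ∧ 3 ∣ g then (L.choose (f / 3) * (L - f / 3).choose (g / 3) : R) else 0 := by
  have h1 := coeff_C_add_C_mul_X_pow_pow (1 + (X : R⟦X⟧) ^ 3) 1 three_pos L f
  have h2 := coeff_C_add_C_mul_X_pow_pow (1 : R) 1 three_pos (L - f / 3) g
  simp only [map_one, one_pow, mul_one, one_mul] at h1 h2
  rw [h1, apply_ite (coeff g), ← map_natCast (C (R := R)), coeff_C_mul, h2, map_zero]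
  by_cases hf : 3 ∣ f <;> by_cases hg : 3 ∣ g <;> simp [hf, hg]

open PowerSeries in
lemma coeff_coeff_prod {R : Type*} [CommRing R] {d : ℕ}
    (F : Fin d → R⟦X⟧⟦X⟧) (m n : ℕ) :
    coeff n (coeff m (∏ t, F t)) =
      ∑ f ∈ finAntidiagonal d m, ∑ g ∈ finAntidiagonal d n, ∏ t, coeff (g t) (coeff (f t) (F t)) := by
  have key : ∀ {S : Type _} [CommRing S] (G : Fin d → S⟦X⟧) (k : ℕ),
      coeff k (∏ t, G t) = ∑ f ∈ finAntidiagonal d k, ∏ t, coeff (f t) (G t) := by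
    intro S _ G k
    rw [PowerSeries.coeff_prod]
    refine sum_equiv Finsupp.equivFunOnFinite (fun l => ?_) fun l _ => rfl
    simp [mem_finsuppAntidiag]
  rw [key, map_sum]
  exact sum_congr rfl fun f _ => key _ _

lemma sum_range_filter_dvd {S : Type*} [AddCommMonoid S] {d : ℕ} (hd : 0 < d) (N : ℕ)
    (F : ℕ → S) :
    ∑ t ∈ range (N + 1) with d ∣ t, F t = ∑ k ∈ range (N / d + 1), F (d * k) := by
  symm
  refine sum_nbij (d * ·) (fun k hk => ?_) (fun a _ b _ h => Nat.eq_of_mul_eq_mul_left hd h)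
    (fun t ht => ?_) fun _ _ => rfl
  · rw [mem_range, Nat.lt_succ_iff, Nat.le_div_iff_mul_le hd] at hk
    simp only [mem_filter, mem_range, dvd_mul_right, and_true]
    rw [mul_comm]
    omega
  · obtain ⟨ht, k, rfl⟩ := mem_filter.mp ht
    refine ⟨k, ?_, rfl⟩
    rw [coe_range, Set.mem_Iio, Nat.lt_succ_iff, Nat.le_div_iff_mul_le hd, mul_comm]
    exact Nat.lt_succ_iff.mp (mem_range.mp ht)

open PowerSeries in
lemma coeff_coeff_hesse_pow {R : Type*} [CommRing R] {N M : ℕ} (hM : M ≤ N) :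
    coeff N (coeff N ((C (1 + (X : R⟦X⟧) ^ 3) + X ^ 3 - 3 * X * C X) ^ M)) =
      ∑ k ∈ range (N / 3 + 1), (-3 : R) ^ (N - 3 * k) * (M.choose (N - 3 * k) *
        ((M - (N - 3 * k)).choose k * (M - (N - 3 * k) - k).choose k)) := by
  set Q : R⟦X⟧⟦X⟧ := C (1 + (X : R⟦X⟧) ^ 3) + X ^ 3 with hQ
  have hterm : ∀ m ≤ N, coeff N (coeff N
      ((-(3 * X * C X) : R⟦X⟧⟦X⟧) ^ m * Q ^ (M - m) * (M.choose m : R⟦X⟧⟦X⟧))) =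
      if 3 ∣ N - m then (-3 : R) ^ m * (M.choose m * ((M - m).choose ((N - m) / 3) *
        (M - m - (N - m) / 3).choose ((N - m) / 3))) else 0 := by
    intro m hm
    have h : (-(3 * X * C X) : R⟦X⟧⟦X⟧) ^ m * Q ^ (M - m) * (M.choose m : R⟦X⟧⟦X⟧) =
        X ^ m * (C (X ^ m * C ((-3 : R) ^ m * (M.choose m : R))) * Q ^ (M - m)) := by
      simp only [map_mul, map_pow, map_natCast, map_neg, map_ofNat]
      rw [neg_eq_neg_one_mul, mul_pow, mul_pow, mul_pow, neg_pow (3 : R⟦X⟧⟦X⟧)]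
      ring
    rw [h, coeff_X_pow_mul', if_pos hm, coeff_C_mul, mul_assoc, coeff_X_pow_mul', if_pos hm,
      coeff_C_mul, hQ, coeff_coeff_cubic_pow]
    simp only [and_self]
    split_ifs <;> ring
  have hext : ∑ m ∈ range (M + 1), (-(3 * X * C X) : R⟦X⟧⟦X⟧) ^ m * Q ^ (M - m) *
      (M.choose m : R⟦X⟧⟦X⟧) = ∑ m ∈ range (N + 1), (-(3 * X * C X) : R⟦X⟧⟦X⟧) ^ m *
      Q ^ (M - m) * (M.choose m : R⟦X⟧⟦X⟧) := by
    refine sum_subset (range_mono (by omega)) fun m _ hm => ?_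
    rw [Nat.choose_eq_zero_of_lt (by simpa using hm)]
    simp
  rw [sub_eq_neg_add, add_pow, hext, map_sum, map_sum,
    sum_congr rfl fun m hm => hterm m (Nat.lt_succ_iff.mp (mem_range.mp hm)),
    ← sum_range_reflect, ← sum_filter_add_sum_filter_not _ (3 ∣ ·)]
  rw [sum_range_filter_dvd three_pos, sum_eq_zero (s := filter _ _), add_zero]
  · refine sum_congr rfl fun k hk => ?_
    have : 3 * k ≤ N := by have := mem_range.mp hk; omega
    rw [show N + 1 - 1 - 3 * k = N - 3 * k by omega, Nat.sub_sub_self this, if_pos ⟨k, rfl⟩,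
      Nat.mul_div_cancel_left k three_pos]
  · intro t ht
    obtain ⟨ht, ht'⟩ := mem_filter.mp ht
    have := mem_range.mp ht
    rw [show N + 1 - 1 - t = N - t by omega, Nat.sub_sub_self (by omega), if_neg ht']

/-- The product of the three linear forms `1 + ω ^ t x + ω ^ (2 t) y` is `1 + x³ + y³ - 3 x y`. -/
lemma prod_linear_eq {R : Type*} [CommRing R] {ω : R} (hω : ω ^ 2 + ω + 1 = 0) (x y : R) :
    ∏ t : Fin 3, (1 + ω ^ (2 * (t : ℕ)) * y + ω ^ (t : ℕ) * x) =
      1 + y ^ 3 + x ^ 3 - 3 * x * y := by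
  have h3 : ω ^ 3 = 1 := by linear_combination (ω - 1) * hω
  have h4 : ω ^ 4 = ω := by linear_combination ω * h3
  have h2 : ω ^ 2 = -1 - ω := by linear_combination hω
  simp only [Fin.prod_univ_three, Fin.val_zero, Fin.val_one, Fin.val_two, mul_zero, pow_zero,
    mul_one, pow_one, one_mul, Nat.reduceMul, h4, h2]
  linear_combination (2 * x * y + x ^ 2 * y + x * y ^ 2 - x ^ 3 - y ^ 3 - x ^ 2 - y ^ 2) * hω

open PowerSeries in
lemma sum_deltaTerm_mul_pow {R : Type*} [CommRing R] {ω : R} (hω : ω ^ 2 + ω + 1 = 0) (N : ℕ) :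
    ∑ v ∈ deltaIndex N, (deltaTerm N v : R) * ω ^ twist v =
      ∑ j ∈ range (N + 1), (N.choose j : R) ^ 2 *
        ∑ k ∈ range (N / 3 + 1), (-3 : R) ^ (N - 3 * k) * ((N - j).choose (N - 3 * k) *
          ((N - j - (N - 3 * k)).choose k * (N - j - (N - 3 * k) - k).choose k)) := by
  have h3 : ω ^ 3 = 1 := by linear_combination (ω - 1) * hω
  rw [deltaIndex, sum_product]
  refine sum_congr rfl fun j _ => ?_
  have hP : C (1 + (X : R⟦X⟧) ^ 3) + X ^ 3 - 3 * X * C X =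
      ∏ t : Fin 3, (C (1 + C (ω ^ (2 * (t : ℕ))) * (X : R⟦X⟧)) + C (C (ω ^ (t : ℕ))) * X) := by
    have hω' : (C (C ω) : R⟦X⟧⟦X⟧) ^ 2 + C (C ω) + 1 = 0 := by
      rw [← map_pow, ← map_pow, ← map_add, ← map_add, ← map_one (C (R := R⟦X⟧)),
        ← map_one (C (R := R)), ← map_add, ← map_add, hω, map_zero, map_zero]
    have := prod_linear_eq hω' X (C X)
    simp only [map_add, map_mul, map_pow, map_one]
    exact this.symm
  rw [← coeff_coeff_hesse_pow (Nat.sub_le N j), hP, ← prod_pow, coeff_coeff_prod, sum_product,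
    mul_sum]
  refine sum_congr rfl fun f _ => ?_
  rw [mul_sum]
  refine sum_congr rfl fun g _ => ?_
  simp only [coeff_coeff_linear_pow, deltaTerm, prod_mul_distrib]
  have hpow : (∏ t : Fin 3, (ω ^ (t : ℕ)) ^ f t) * ∏ t : Fin 3, (ω ^ (2 * (t : ℕ))) ^ g t =
      ω ^ twist (j, f, g) := by
    simp only [Fin.prod_univ_three, Fin.val_zero, Fin.val_one, Fin.val_two, pow_zero, pow_one,
      one_mul, one_pow, twist, pow_add, pow_mul]
    rw [show (ω ^ 2) ^ 2 = ω by linear_combination ω * h3]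
    ring
  rw [← hpow]
  push_cast
  ring

lemma choose_sq_mul_choose {N k : ℕ} (hk : 3 * k ≤ N) {j : ℕ} (hj : j ≤ N) :
    N.choose j ^ 2 * ((N - j).choose (N - 3 * k) *
      ((N - j - (N - 3 * k)).choose k * (N - j - (N - 3 * k) - k).choose k)) =
    N.choose (3 * k) * ((3 * k).factorial / k.factorial ^ 3) * (k.choose j * N.choose j) := by
  rcases lt_or_ge k j with hkj | hjk
  · rw [Nat.choose_eq_zero_of_lt hkj]
    rcases lt_or_ge (3 * k) j with h | h
    · rw [Nat.choose_eq_zero_of_lt (show N - j < N - 3 * k by omega)]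
      simp
    · rw [Nat.choose_eq_zero_of_lt (show N - j - (N - 3 * k) - k < k by omega)]
      simp
  have h2 := Nat.choose_mul_factorial_mul_factorial (show N - 3 * k ≤ N - j by omega)
  have h3 := Nat.choose_mul_factorial_mul_factorial (show k ≤ N - j - (N - 3 * k) by omega)
  have h4 := Nat.choose_mul_factorial_mul_factorial (show k ≤ N - j - (N - 3 * k) - k by omega)
  have h1 := Nat.choose_mul_factorial_mul_factorial hj
  have h5 := Nat.choose_mul_factorial_mul_factorial hk
  have h7 := Nat.choose_mul_factorial_mul_factorial hjk
  have h6 : (3 * k).factorial / k.factorial ^ 3 * k.factorial ^ 3 = (3 * k).factorial := by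
    refine Nat.div_mul_cancel ?_
    have := Nat.prod_factorial_dvd_factorial_sum (univ : Finset (Fin 3)) fun _ => k
    simpa using this
  generalize (3 * k).factorial / k.factorial ^ 3 = D at h6 ⊢
  rw [show N - j - (N - 3 * k) - k - k = k - j by omega] at h4
  have hpos : 0 < j.factorial * (N - 3 * k).factorial * k.factorial ^ 2 * (k - j).factorial := by
    positivity
  have key : N.choose j * ((N - j).choose (N - 3 * k) *
      ((N - j - (N - 3 * k)).choose k * (N - j - (N - 3 * k) - k).choose k)) =
      N.choose (3 * k) * D * k.choose j := by
    apply Nat.eq_of_mul_eq_mul_right hpos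
    rw [← h2, ← h3, ← h4, ← h5, ← h6] at h1
    calc _ = _ := ?_
      _ = _ := h1
      _ = _ := ?_
    · ring
    · rw [show N.choose (3 * k) * D * k.choose j * (j.factorial * (N - 3 * k).factorial *
          k.factorial ^ 2 * (k - j).factorial) = N.choose (3 * k) * D * ((N - 3 * k).factorial *
          k.factorial ^ 2) * (k.choose j * j.factorial * (k - j).factorial) by ring, h7]
      ring
  rw [pow_two, mul_assoc, key]
  ring

lemma sum_choose_sq_mul_choose {N k : ℕ} (hk : 3 * k ≤ N) :
    ∑ j ∈ range (N + 1), N.choose j ^ 2 * ((N - j).choose (N - 3 * k) *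
      ((N - j - (N - 3 * k)).choose k * (N - j - (N - 3 * k) - k).choose k)) =
    N.choose (3 * k) * (N + k).choose N * ((3 * k).factorial / k.factorial ^ 3) := by
  rw [sum_congr rfl fun j hj => choose_sq_mul_choose hk (Nat.lt_succ_iff.mp (mem_range.mp hj)),
    ← mul_sum, add_comm N k, Nat.add_choose_eq,
    Nat.sum_antidiagonal_eq_sum_range_succ fun i j => k.choose i * N.choose j,
    sum_congr rfl fun j hj => by
      rw [← Nat.choose_symm (Nat.lt_succ_iff.mp (mem_range.mp hj))]]
  ring

lemma sum_deltaTerm_mul_pow_eq {R : Type*} [CommRing R] {ω : R} (hω : ω ^ 2 + ω + 1 = 0)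
    (N : ℕ) :
    ∑ v ∈ deltaIndex N, (deltaTerm N v : R) * ω ^ twist v = (-1) ^ N * (aperyDelta N : R) := by
  rw [sum_deltaTerm_mul_pow hω, aperyDelta]
  simp only [mul_sum]
  rw [sum_comm]
  simp only [Int.cast_sum, Int.cast_mul, Int.cast_pow, Int.cast_neg, Int.cast_one,
    Int.cast_ofNat, Int.cast_natCast]
  rw [mul_sum]
  refine sum_congr rfl fun k hk => ?_
  have hk' : 3 * k ≤ N := by have := mem_range.mp hk; omega
  have h := congrArg (Nat.cast (R := R)) (sum_choose_sq_mul_choose hk')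
  have hs : (-3 : R) ^ (N - 3 * k) = (-1) ^ N * (-1) ^ k * 3 ^ (N - 3 * k) := by
    obtain ⟨m, rfl⟩ := Nat.exists_eq_add_of_le hk'
    rw [neg_pow, Nat.add_sub_cancel_left, ← pow_add, show 3 * k + m + k = 2 * (2 * k) + m by ring,
      pow_add _ (2 * (2 * k)), pow_mul]
    simp
  push_cast at h
  calc _ = (-3 : R) ^ (N - 3 * k) * ∑ j ∈ range (N + 1), (N.choose j : R) ^ 2 *
        ((N - j).choose (N - 3 * k) * ((N - j - (N - 3 * k)).choose k *
          (N - j - (N - 3 * k) - k).choose k)) := by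
        rw [mul_sum]
        exact sum_congr rfl fun j _ => by ring
    _ = _ := by
        rw [h, hs]
        ring

lemma deltaSum_eq (N : ℕ) : deltaSum N = (-1) ^ N * (2 * aperyDelta N) := by
  have hprim := Complex.isPrimitiveRoot_exp 3 (by norm_num)
  set ω : ℂ := Complex.exp (2 * Real.pi * Complex.I / (3 : ℕ)) with hdef
  have h3 : ω ^ 3 = 1 := hprim.pow_eq_one
  have hω : ω ^ 2 + ω + 1 = 0 := by
    have := hprim.geom_sum_eq_zero (by norm_num)
    simp only [sum_range_succ, range_zero, sum_empty, pow_zero, pow_one] at this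
    linear_combination this
  have hω' : (ω ^ 2) ^ 2 + ω ^ 2 + 1 = 0 := by linear_combination hω + ω * h3
  have htr : ∀ d, (cubeTrace d : ℂ) = ω ^ d + (ω ^ 2) ^ d := by
    intro d
    have hmod : ω ^ d = ω ^ (d % 3) := by
      conv_lhs => rw [← Nat.div_add_mod d 3, pow_add, pow_mul, h3, one_pow, one_mul]
    have hd : d % 3 < 3 := Nat.mod_lt _ (by norm_num)
    rw [← pow_mul, mul_comm, pow_mul, hmod, cubeTrace]
    simp only [Nat.dvd_iff_mod_eq_zero]
    interval_cases d % 3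
    · norm_num
    · simp only [one_ne_zero, if_false]
      push_cast
      linear_combination -hω
    · simp only [OfNat.ofNat_ne_zero, if_false]
      push_cast
      linear_combination -hω'
  have : (deltaSum N : ℂ) = (-1) ^ N * (2 * aperyDelta N) := by
    rw [deltaSum]
    push_cast
    simp only [htr, mul_add, sum_add_distrib]
    rw [sum_deltaTerm_mul_pow_eq hω, sum_deltaTerm_mul_pow_eq hω']
    ring
  exact_mod_cast this

theorem supercongruence_delta (p : ℕ) (hp : p.Prime) (hp3 : 3 ≤ p)
    (n r : ℕ) (hn : 0 < n) (hr : 0 < r) :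
    (p : ℤ) ^ (2 * r) ∣ aperyDelta (p ^ r * n) - aperyDelta (p ^ (r - 1) * n) := by
  obtain ⟨e, rfl⟩ : ∃ e, r = e + 1 := ⟨r - 1, by omega⟩
  have h := pow_dvd_deltaSum_sub hp hp3 (Dvd.intro n rfl : p ^ e ∣ p ^ e * n)
  have hodd : Odd p := hp.odd_of_ne_two (by omega)
  have hc : IsCoprime ((p : ℤ) ^ (2 * (e + 1))) ((-1) ^ (p ^ e * n) * 2) := by
    refine IsCoprime.pow_left (IsCoprime.mul_right ?_ ?_)
    · exact (isCoprime_one_right.neg_right).pow_right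
    · exact Nat.isCoprime_iff_coprime.mpr hodd.coprime_two_right
  rw [deltaSum_eq, deltaSum_eq, pow_mul (-1 : ℤ) p, hodd.neg_one_pow,
    ← mul_sub, ← mul_sub, ← mul_assoc ((-1 : ℤ) ^ _) 2, ← mul_assoc p, ← pow_succ'] at h
  exact hc.dvd_of_dvd_mul_left h
end

section
/- (Gessel–Lucas congruence for the Apéry numbers.) Let A(n) = \sum_{k=0}^{n} \binom{n}{k}^2 \binom{n+k}{k}^2 and define the rational sequence A'(n) = 2 \sum_{k=0}^{n} \binom{n}{k}^2 \binom{n+k}{k}^2 (H_{n+k} - H_{n-k}), where H_m is the m-th harmonic number. Then for every prime p \ge 3 and all integers n \ge 0 and k with 0 \le k < p, the rational number A(p n + k) - A(k) A(n) - p n A'(k) A(n) has p-adic valuation at least 2; that is, A(p n + k) \equiv A(k) A(n) + p n A'(k) A(n) (mod p^2) in the p-adic sense. -/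
/-- The `m`-th harmonic number. -/
def harm (m : ℕ) : ℚ := ∑ j ∈ Finset.range m, 1 / (j + 1)

/-- The Apéry numbers (as rationals). -/
def apery (n : ℕ) : ℚ :=
  ∑ k ∈ Finset.range (n + 1), (n.choose k : ℚ) ^ 2 * ((n + k).choose k : ℚ) ^ 2

/-- The formal derivative of the Apéry numbers. -/
def apery' (n : ℕ) : ℚ :=
  2 * ∑ k ∈ Finset.range (n + 1),
    (n.choose k : ℚ) ^ 2 * ((n + k).choose k : ℚ) ^ 2 * (harm (n + k) - harm (n - k))

namespace Lagrange

open Polynomial Finset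

variable {F ι : Type*} [Field F] [DecidableEq ι] {s : Finset ι} {v : ι → F} {f : F[X]}

theorem basis_eq_nodalWeight_mul_nodal_erase (i : ι) :
    Lagrange.basis s v i = C (nodalWeight s v i) * nodal (s.erase i) v := by
  simp only [Lagrange.basis, basisDivisor, nodalWeight, nodal, prod_mul_distrib, map_prod]

theorem nodalWeight_mul_eval_nodal_erase_erase (hvs : Set.InjOn v s) {i j : ι} (hj : j ∈ s)
    (hi : i ∈ s.erase j) :
    nodalWeight s v j * eval (v j) (nodal ((s.erase j).erase i) v) = (v j - v i)⁻¹ := by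
  rw [nodalWeight, eval_nodal, ← mul_prod_erase _ _ hi, mul_assoc, ← prod_mul_distrib,
    prod_eq_one, mul_one]
  intro l hl
  simp only [mem_erase] at hl
  exact inv_mul_cancel₀ (sub_ne_zero.2 fun h => hl.2.1 (hvs hl.2.2 hj h.symm))

/-- The derivative at a node of a polynomial of degree less than the number of nodes. -/
theorem nodalWeight_mul_eval_derivative (hvs : Set.InjOn v s) (hf : f.degree < #s) {j : ι}
    (hj : j ∈ s) :
    nodalWeight s v j * eval (v j) (derivative f) =
      eval (v j) f * nodalWeight s v j * ∑ i ∈ s, (v j - v i)⁻¹ +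
        ∑ i ∈ s, eval (v i) f * nodalWeight s v i * (v j - v i)⁻¹ := by
  have hinterp := eq_interpolate hvs hf
  rw [interpolate_apply] at hinterp
  have hself : nodalWeight s v j * eval (v j) (derivative (nodal (s.erase j) v)) =
      ∑ i ∈ s, (v j - v i)⁻¹ := by
    rw [derivative_nodal, eval_finsetSum, mul_sum, ← add_sum_erase _ _ hj, sub_self, inv_zero,
      zero_add]
    exact sum_congr rfl fun i hi => nodalWeight_mul_eval_nodal_erase_erase hvs hj hi
  have hne : ∀ i ∈ s.erase j, nodalWeight s v j * eval (v j) (derivative (nodal (s.erase i) v)) =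
      (v j - v i)⁻¹ := by
    intro i hi
    have hij := mem_erase.1 hi
    rw [eval_nodal_derivative_eval_node_eq (mem_erase.2 ⟨hij.1.symm, hj⟩), erase_right_comm]
    exact nodalWeight_mul_eval_nodal_erase_erase hvs hj hi
  have hder : eval (v j) (derivative f) = ∑ i ∈ s, eval (v i) f * nodalWeight s v i *
      eval (v j) (derivative (nodal (s.erase i) v)) := by
    conv_lhs => rw [hinterp]
    simp [eval_finsetSum, basis_eq_nodalWeight_mul_nodal_erase, mul_assoc]
  rw [hder, mul_sum, ← add_sum_erase _ _ hj, ← add_sum_erase _ (fun i => _ * (v j - v i)⁻¹) hj,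
    sub_self, inv_zero, mul_zero, zero_add, ← hself]
  congr 1
  · ring
  · refine sum_congr rfl fun i hi => ?_
    rw [← hne i hi]
    ring

/-- The sum of the residues of `(f / nodal s v) ^ 2` vanishes when `deg f < #s`. -/
theorem sum_sq_nodalWeight_mul_eq_zero [CharZero F] (hvs : Set.InjOn v s) (hf : f.degree < #s) :
    ∑ j ∈ s, eval (v j) f * nodalWeight s v j ^ 2 *
      (eval (v j) (derivative f) - eval (v j) f * ∑ i ∈ s, (v j - v i)⁻¹) = 0 := by
  set c : ι → F := fun i => eval (v i) f * nodalWeight s v i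
  have h : ∑ j ∈ s, eval (v j) f * nodalWeight s v j ^ 2 *
      (eval (v j) (derivative f) - eval (v j) f * ∑ i ∈ s, (v j - v i)⁻¹) =
      ∑ j ∈ s, ∑ i ∈ s, c j * c i * (v j - v i)⁻¹ := by
    refine sum_congr rfl fun j hj => ?_
    simp only [mul_assoc (c j), ← mul_sum]
    linear_combination (c j) * nodalWeight_mul_eval_derivative hvs hf hj
  have hanti : ∑ j ∈ s, ∑ i ∈ s, c j * c i * (v j - v i)⁻¹ =
      -∑ j ∈ s, ∑ i ∈ s, c j * c i * (v j - v i)⁻¹ := by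
    conv_lhs => rw [sum_comm]
    simp only [← sum_neg_distrib]
    refine sum_congr rfl fun j _ => sum_congr rfl fun i _ => ?_
    rw [← neg_sub (v j) (v i), inv_neg]
    ring
  rw [h]
  exact self_eq_neg.1 hanti

end Lagrange

section AperyNumbers

open Finset Nat

theorem harm_succ (m : ℕ) : harm (m + 1) = harm m + 1 / (m + 1) := by
  simp [harm, sum_range_succ]

theorem harm_zero : harm 0 = 0 := by
  simp [harm]

/-- `aperyRoot n k ^ 2` is the `k`-th summand of the Apéry number `apery n`. -/
def aperyRoot (n k : ℕ) : ℚ := n.choose k * (n + k).choose k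

theorem apery_eq_sum_sq (n : ℕ) : apery n = ∑ k ∈ range (n + 1), aperyRoot n k ^ 2 := by
  simp only [apery, aperyRoot, mul_pow]

theorem apery'_eq_sum_sq (n : ℕ) :
    apery' n = 2 * ∑ k ∈ range (n + 1), aperyRoot n k ^ 2 * (harm (n + k) - harm (n - k)) := by
  simp only [apery', aperyRoot, mul_pow]

theorem aperyRoot_eq_zero_of_lt {n k : ℕ} (h : n < k) : aperyRoot n k = 0 := by
  simp [aperyRoot, choose_eq_zero_of_lt h]

theorem aperyRoot_add (k r : ℕ) :
    aperyRoot (k + r) k = (k + r + k)! / ((k ! : ℚ) ^ 2 * r !) := by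
  rw [aperyRoot, cast_add_choose, add_comm (k + r) k, cast_add_choose]
  field_simp

theorem apery_eq_sum_range {n N : ℕ} (h : n < N) :
    apery n = ∑ k ∈ range N, aperyRoot n k ^ 2 := by
  rw [apery_eq_sum_sq]
  refine sum_subset (range_subset_range.2 h) fun k _ hk => ?_
  rw [aperyRoot_eq_zero_of_lt (by simpa using hk), zero_pow two_ne_zero]

theorem apery'_eq_sum_range {n N : ℕ} (h : n < N) :
    apery' n = 2 * ∑ k ∈ range N, aperyRoot n k ^ 2 * (harm (n + k) - harm (n - k)) := by
  rw [apery'_eq_sum_sq]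
  congr 1
  refine sum_subset (range_subset_range.2 h) fun k _ hk => ?_
  rw [aperyRoot_eq_zero_of_lt (by simpa using hk), zero_pow two_ne_zero, zero_mul]

section HarmonicIdentity

open Polynomial Lagrange

theorem eval_prod_X_add (n j : ℕ) :
    eval (j : ℚ) (∏ i ∈ range n, (X + C ((i : ℚ) + 1))) = (j + n)! / j ! := by
  induction n with
  | zero => simp [div_self (cast_ne_zero.2 (factorial_ne_zero j) : (j ! : ℚ) ≠ 0)]
  | succ n ih =>
    rw [prod_range_succ, eval_mul, ih, ← add_assoc, factorial_succ]
    push_cast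
    simp only [eval_add, eval_X, eval_C]
    ring

theorem eval_derivative_prod_X_add (n j : ℕ) :
    eval (j : ℚ) (derivative (∏ i ∈ range n, (X + C ((i : ℚ) + 1)))) =
      (j + n)! / j ! * (harm (j + n) - harm j) := by
  induction n with
  | zero => simp
  | succ n ih =>
    rw [prod_range_succ, derivative_mul, eval_add, eval_mul, eval_mul, ih, eval_prod_X_add,
      ← add_assoc, harm_succ, factorial_succ, derivative_X_add_C]
    have : ((j : ℚ) + n + 1) ≠ 0 := by positivity
    push_cast
    simp only [eval_add, eval_X, eval_C, eval_one]
    field_simp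
    ring

theorem sum_range_inv_sub (j r : ℕ) :
    ∑ i ∈ range (j + r + 1), ((j : ℚ) - i)⁻¹ = harm j - harm r := by
  induction r with
  | zero =>
    rw [add_zero, sum_range_succ, sub_self, inv_zero, add_zero, harm_zero, sub_zero, harm,
      ← sum_range_reflect]
    refine sum_congr rfl fun i hi => ?_
    have : i + 1 ≤ j := mem_range.1 hi
    rw [Nat.sub_sub, add_comm 1 i, cast_sub this]
    push_cast
    rw [one_div, sub_sub_eq_add_sub]
    ring
  | succ r ih =>
    rw [← add_assoc, sum_range_succ, ih, harm_succ]
    push_cast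
    rw [show (j : ℚ) - (j + r + 1) = -(r + 1) by ring, inv_neg, one_div]
    ring

theorem nodalWeight_range_sq (j r : ℕ) :
    nodalWeight (range (j + r + 1)) (Nat.cast : ℕ → ℚ) j ^ 2 = (((j ! : ℚ) * r !) ^ 2)⁻¹ := by
  induction r with
  | zero =>
    rw [add_zero, nodalWeight, range_add_one, erase_insert notMem_range_self, prod_inv_distrib,
      inv_pow, factorial_zero, cast_one, mul_one, ← prod_range_add_one_eq_factorial,
      ← prod_range_reflect]
    push_cast
    congr 2
    refine prod_congr rfl fun i hi => ?_
    have : i + 1 ≤ j := mem_range.1 hi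
    rw [Nat.sub_sub, add_comm 1 i, cast_sub this]
    push_cast
    ring
  | succ r ih =>
    rw [nodalWeight] at ih ⊢
    rw [← add_assoc, range_add_one, erase_insert_of_ne (by omega), prod_insert (by simp), mul_pow,
      ih, factorial_succ]
    push_cast
    rw [show (j : ℚ) - (j + r + 1) = -(r + 1) by ring, inv_neg, neg_sq, ← inv_pow, ← inv_pow,
      ← mul_pow, ← mul_inv]
    ring

/-- The formal derivative of the summand `aperyRoot n j ^ 2` with respect to `j` sums to zero. -/
theorem sum_aperyRoot_sq_mul_harm (n : ℕ) :
    ∑ j ∈ range (n + 1), aperyRoot n j ^ 2 * (harm (n + j) + harm (n - j) - 2 * harm j) = 0 := by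
  have hdeg : (∏ i ∈ range n, (X + C ((i : ℚ) + 1)) : ℚ[X]).degree <
      (#(range (n + 1)) : WithBot ℕ) := by
    rw [degree_prod]
    simp only [degree_X_add_C, sum_const, card_range, nsmul_eq_mul, mul_one]
    exact_mod_cast lt_succ_self n
  rw [← sum_sq_nodalWeight_mul_eq_zero (v := (Nat.cast : ℕ → ℚ)) cast_injective.injOn hdeg]
  refine sum_congr rfl fun j hj => ?_
  obtain ⟨r, rfl⟩ := exists_add_of_le (le_of_lt_succ (mem_range.1 hj))
  rw [eval_prod_X_add, eval_derivative_prod_X_add, sum_range_inv_sub, nodalWeight_range_sq,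
    aperyRoot_add, add_tsub_cancel_left, add_comm (j + r) j]
  field_simp
  ring

end HarmonicIdentity

section PadicBall

variable (p : ℕ) [Fact p.Prime]

/-- The rational numbers of `p`-adic valuation at least `e`. -/
def padicBall (e : ℤ) : AddSubgroup ℚ where
  carrier := {x | padicNorm p x ≤ (p : ℚ) ^ (-e)}
  add_mem' hx hy := padicNorm.nonarchimedean.trans (max_le hx hy)
  zero_mem' := by
    simp only [Set.mem_ofPred_eq, padicNorm.zero]
    positivity
  neg_mem' := by simp

variable {p} {e e' : ℤ} {x y h h' : ℚ}

theorem mem_padicBall : x ∈ padicBall p e ↔ padicNorm p x ≤ (p : ℚ) ^ (-e) := Iff.rfl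

theorem mem_padicBall_iff_padicValRat : x ∈ padicBall p e ↔ x = 0 ∨ e ≤ padicValRat p x := by
  have hp : 1 < (p : ℚ) := by exact_mod_cast (Fact.out : p.Prime).one_lt
  rcases eq_or_ne x 0 with rfl | hx
  · simp [zero_mem]
  · rw [mem_padicBall, padicNorm.eq_zpow_of_nonzero hx, zpow_le_zpow_iff_right₀ hp]
    simp [hx]

theorem padicBall_anti (he : e ≤ e') (hx : x ∈ padicBall p e') : x ∈ padicBall p e := by
  have hp : 1 ≤ (p : ℚ) := by exact_mod_cast (Fact.out : p.Prime).one_lt.le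
  exact le_trans hx (zpow_le_zpow_right₀ hp (neg_le_neg he))

theorem mul_mem_padicBall {d : ℤ} (hx : x ∈ padicBall p e) (hy : y ∈ padicBall p e')
    (hd : d = e + e' := by norm_num) : x * y ∈ padicBall p d := by
  subst hd
  have hp : (p : ℚ) ≠ 0 := by exact_mod_cast (Fact.out : p.Prime).ne_zero
  rw [mem_padicBall] at *
  rw [padicNorm.mul, neg_add, zpow_add₀ hp]
  exact mul_le_mul hx hy (padicNorm.nonneg _) (by positivity)

theorem natCast_mem_padicBall (m : ℕ) : (m : ℚ) ∈ padicBall p 0 := by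
  simpa [mem_padicBall] using padicNorm.of_nat m

theorem natCast_mem_padicBall_one {m : ℕ} (hm : p ∣ m) : (m : ℚ) ∈ padicBall p 1 := by
  have := padicNorm.dvd_iff_norm_le (p := p) (n := 1) (z := m)
  rw [pow_one] at this
  exact_mod_cast this.1 (by exact_mod_cast hm)

theorem prime_mem_padicBall : (p : ℚ) ∈ padicBall p 1 := natCast_mem_padicBall_one dvd_rfl

theorem inv_mem_padicBall (hx : padicNorm p x = 1) : x⁻¹ ∈ padicBall p 0 := by
  rw [mem_padicBall, ← one_div, padicNorm.div, hx]
  simp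

theorem inv_natCast_mem_padicBall {m : ℕ} (hm : ¬p ∣ m) : (m : ℚ)⁻¹ ∈ padicBall p 0 :=
  inv_mem_padicBall ((padicNorm.nat_eq_one_iff m).2 hm)

theorem inv_natCast_mem_padicBall_neg_one {m : ℕ} (hm0 : m ≠ 0) (hm : m < 2 * p) :
    (m : ℚ)⁻¹ ∈ padicBall p (-1) := by
  have hp := (Fact.out : p.Prime)
  by_cases hdvd : p ∣ m
  · obtain ⟨c, rfl⟩ := hdvd
    obtain rfl : c = 1 := by
      have : c < 2 := lt_of_mul_lt_mul_left (by linarith) (zero_le p)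
      have : c ≠ 0 := right_ne_zero_of_mul hm0
      omega
    rw [mem_padicBall, mul_one, ← one_div, padicNorm.div, padicNorm.padicNorm_p_of_prime]
    simp
  · exact padicBall_anti (by norm_num) (inv_natCast_mem_padicBall hdvd)

theorem harm_mem_padicBall {m : ℕ} (hm : m < p) : harm m ∈ padicBall p 0 := by
  refine sum_mem fun j hj => ?_
  have hj := mem_range.1 hj
  have := inv_natCast_mem_padicBall (not_dvd_of_pos_of_lt j.succ_pos (by omega : j.succ < p))
  simpa using this

theorem harm_mem_padicBall_neg_one {m : ℕ} (hm : m < 2 * p) : harm m ∈ padicBall p (-1) := by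
  refine sum_mem fun j hj => ?_
  have hj := mem_range.1 hj
  have := inv_natCast_mem_padicBall_neg_one j.succ_ne_zero (by omega : j.succ < 2 * p)
  simpa using this

theorem harm_pred_mem_padicBall_one (hp3 : 3 ≤ p) : harm (p - 1) ∈ padicBall p 1 := by
  have hunit : ∀ j ∈ range (p - 1), ((j + 1 : ℕ) : ℚ)⁻¹ ∈ padicBall p 0 := fun j hj =>
    inv_natCast_mem_padicBall (not_dvd_of_pos_of_lt j.succ_pos (by
      have := mem_range.1 hj
      omega))
  have htwo : 2 * harm (p - 1) = p * ∑ j ∈ range (p - 1),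
      ((j + 1 : ℕ) : ℚ)⁻¹ * ((p - 1 - 1 - j + 1 : ℕ) : ℚ)⁻¹ := by
    have hreflect := sum_range_reflect (fun j : ℕ => 1 / ((j : ℚ) + 1)) (p - 1)
    rw [two_mul, harm]
    nth_rw 2 [← hreflect]
    rw [← sum_add_distrib, mul_sum]
    refine sum_congr rfl fun j hj => ?_
    have hj := mem_range.1 hj
    have hp : (p : ℚ) = (j + 1 : ℕ) + (p - 1 - 1 - j + 1 : ℕ) := by
      rw [← cast_add]
      congr 1
      omega
    rw [hp]
    push_cast
    field_simp
    ring
  have hmem : (p : ℚ) * ∑ j ∈ range (p - 1),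
      ((j + 1 : ℕ) : ℚ)⁻¹ * ((p - 1 - 1 - j + 1 : ℕ) : ℚ)⁻¹ ∈ padicBall p 1 := by
    refine mul_mem_padicBall (e' := 0) prime_mem_padicBall (sum_mem fun j hj => ?_)
    refine mul_mem_padicBall (hunit j hj) (hunit (p - 1 - 1 - j) (mem_range.2 ?_))
    have := mem_range.1 hj
    omega
  rw [← htwo] at hmem
  have htwoinv : ((2 : ℕ) : ℚ)⁻¹ ∈ padicBall p 0 :=
    inv_natCast_mem_padicBall (not_dvd_of_pos_of_lt two_pos hp3)
  simpa using mul_mem_padicBall (d := 1) htwoinv hmem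

variable (p) in
/-- `x` agrees with `1 + p * h` modulo `p ^ 2`, where `h` is `p`-integral. -/
def IsOneAddMul (h x : ℚ) : Prop :=
  h ∈ padicBall p 0 ∧ x - (1 + p * h) ∈ padicBall p 2

theorem isOneAddMul_self (hh : h ∈ padicBall p 0) : IsOneAddMul p h (1 + p * h) :=
  ⟨hh, by simp [zero_mem]⟩

theorem prime_mul_mem_padicBall (hh : h ∈ padicBall p 0) : p * h ∈ padicBall p 1 :=
  mul_mem_padicBall prime_mem_padicBall hh

theorem one_mem_padicBall : (1 : ℚ) ∈ padicBall p 0 := by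
  exact_mod_cast natCast_mem_padicBall (p := p) 1

namespace IsOneAddMul

theorem padicNorm_eq_one (hx : IsOneAddMul p h x) : padicNorm p x = 1 := by
  have hp : (1 : ℚ) < p := by exact_mod_cast (Fact.out : p.Prime).one_lt
  have hmem : x - 1 ∈ padicBall p 1 := by
    have := add_mem (padicBall_anti (e := 1) (by norm_num) hx.2) (prime_mul_mem_padicBall hx.1)
    convert this using 1
    ring
  have hlt : padicNorm p (x - 1) < 1 :=
    lt_of_le_of_lt hmem (by simpa using inv_lt_one_of_one_lt₀ hp)
  have h1 : padicNorm p (1 : ℚ) = 1 := padicNorm.one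
  have := padicNorm.add_eq_max_of_ne (p := p) (q := x - 1) (r := 1) (by rw [h1]; exact hlt.ne)
  rwa [sub_add_cancel, h1, max_eq_right hlt.le] at this

theorem mem_padicBall_zero (hx : IsOneAddMul p h x) : x ∈ padicBall p 0 := by
  simp [mem_padicBall, hx.padicNorm_eq_one]

theorem mul (hx : IsOneAddMul p h x) (hy : IsOneAddMul p h' y) :
    IsOneAddMul p (h + h') (x * y) := by
  refine ⟨add_mem hx.1 hy.1, ?_⟩
  have h1 := mul_mem_padicBall (d := 2) hx.2 hy.mem_padicBall_zero
  have h2 := mul_mem_padicBall (d := 2) (isOneAddMul_self hx.1).mem_padicBall_zero hy.2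
  have h3 := mul_mem_padicBall (d := 2) (prime_mul_mem_padicBall hx.1)
    (prime_mul_mem_padicBall hy.1)
  convert add_mem (add_mem h1 h2) h3 using 1
  ring

theorem inv (hx : IsOneAddMul p h x) : IsOneAddMul p (-h) x⁻¹ := by
  refine ⟨neg_mem hx.1, ?_⟩
  have hx0 : x ≠ 0 := by
    rintro rfl
    simpa using hx.padicNorm_eq_one
  have h1 := mul_mem_padicBall (d := 2) (isOneAddMul_self (neg_mem hx.1)).mem_padicBall_zero hx.2
  have h2 := mul_mem_padicBall (d := 2) (prime_mul_mem_padicBall hx.1)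
    (prime_mul_mem_padicBall hx.1)
  convert mul_mem_padicBall (d := 2) (inv_mem_padicBall hx.padicNorm_eq_one) (sub_mem h2 h1) using 1
  field_simp
  ring

theorem congr_left (hx : IsOneAddMul p h x) (hh : h' - h ∈ padicBall p 1) :
    IsOneAddMul p h' x := by
  refine ⟨?_, ?_⟩
  · convert add_mem (padicBall_anti (by norm_num) hh) hx.1 using 1
    ring
  · convert sub_mem hx.2 (mul_mem_padicBall (d := 2) prime_mem_padicBall hh) using 1
    ring

end IsOneAddMul

theorem isOneAddMul_choose (a : ℕ) {r : ℕ} (hr : r < p) :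
    IsOneAddMul p (a * harm r) ((p * a + r).choose r) := by
  induction r with
  | zero =>
    have := isOneAddMul_self (p := p) (zero_mem _)
    simpa [harm_zero] using this
  | succ r ih =>
    have hinv := inv_natCast_mem_padicBall (not_dvd_of_pos_of_lt r.succ_pos hr)
    have hmul := mul_mem_padicBall (d := 0) (natCast_mem_padicBall (p := p) a) hinv
    convert (ih (by omega)).mul (isOneAddMul_self hmul) using 1
    · rw [harm_succ]
      push_cast
      ring
    · have := add_one_mul_choose_eq (p * a + r) r
      have hcast : ((p : ℚ) * a + r + 1) * (p * a + r).choose r =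
          (p * a + r + 1).choose (r + 1) * (r + 1) := by exact_mod_cast this
      rw [← add_assoc]
      push_cast
      field_simp
      linear_combination -hcast

/-- `(p * a + r)! / (p ^ a * a! * (p - 1)! ^ a * r!)` to first order in `p`. -/
theorem isOneAddMul_factorial (hp3 : 3 ≤ p) (a : ℕ) {r : ℕ} (hr : r < p) :
    IsOneAddMul p (a * harm r)
      ((p * a + r)! / (((p : ℚ) * (p - 1)!) ^ a * a ! * r !)) := by
  have hp0 : (p : ℚ) ≠ 0 := by exact_mod_cast (Fact.out : p.Prime).ne_zero
  have hbase : IsOneAddMul p 0 ((p * a)! / (((p : ℚ) * (p - 1)!) ^ a * a !)) := by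
    induction a with
    | zero =>
      have := isOneAddMul_self (p := p) (zero_mem _)
      simpa using this
    | succ a ih =>
      have hstep := (isOneAddMul_choose (p := p) a (r := p - 1) (by omega)).congr_left (h' := 0) (by
        have := mul_mem_padicBall (d := 1) (natCast_mem_padicBall (p := p) a)
          (harm_pred_mem_padicBall_one hp3)
        simpa using this)
      convert ih.mul hstep using 1
      · simp
      · have : p * (a + 1) = (p * a + (p - 1)) + 1 := by
          rw [mul_add]
          omega
        have hfac : ((p * (a + 1))! : ℚ) = p * (a + 1) * (p * a + (p - 1))! := by
          rw [this, factorial_succ, ← this]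
          push_cast
          rfl
        rw [hfac, add_comm (p * a), cast_add_choose, factorial_succ]
        push_cast
        field_simp
        ring
  convert hbase.mul (isOneAddMul_choose a hr) using 1
  · simp
  · rw [add_comm (p * a), cast_add_choose]
    field_simp

end PadicBall

theorem sum_range_mul {M : Type*} [AddCommMonoid M] (f : ℕ → M) (p n : ℕ) :
    ∑ i ∈ range (p * n), f i = ∑ m ∈ range n, ∑ j ∈ range p, f (p * m + j) := by
  induction n with
  | zero => simp
  | succ n ih => rw [mul_add_one, sum_range_add, sum_range_succ, ih]

section Congruence

variable {p : ℕ} [Fact p.Prime] {n k m j : ℕ}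

theorem aperyRoot_mem_padicBall_zero (n k : ℕ) : aperyRoot n k ∈ padicBall p 0 :=
  mul_mem_padicBall (natCast_mem_padicBall _) (natCast_mem_padicBall _)

theorem aperyRoot_mem_padicBall_one (n m : ℕ) (hk : k < p) (hj : j < p)
    (h : k < j ∨ p ≤ k + j) : aperyRoot (p * n + k) (p * m + j) ∈ padicBall p 1 := by
  have hp := (Fact.out : p.Prime).pos
  have hdvd (N : ℕ) (hN : N % p < j) : p ∣ N.choose (p * m + j) := by
    have := Choose.choose_modEq_choose_mod_mul_choose_div_nat (n := N) (k := p * m + j) (p := p)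
    rw [mul_add_mod, mod_eq_of_lt hj, choose_eq_zero_of_lt hN, zero_mul] at this
    exact (modEq_zero_iff_dvd).1 this
  rcases h with h | h
  · refine mul_mem_padicBall (natCast_mem_padicBall_one (hdvd _ ?_)) (natCast_mem_padicBall _)
    rwa [mul_add_mod, mod_eq_of_lt hk]
  · refine mul_mem_padicBall (natCast_mem_padicBall _) (natCast_mem_padicBall_one (hdvd _ ?_))
    rw [show p * n + k + (p * m + j) = p * (n + m + 1) + (k + j - p) by
      rw [mul_add, mul_add, mul_one]
      omega, mul_add_mod, mod_eq_of_lt (by omega)]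
    omega

theorem exists_aperyRoot_eq_mul (hp3 : 3 ≤ p) (hm : m ≤ n) (hj : j ≤ k) (hkj : k + j < p) :
    ∃ x, IsOneAddMul p
        (n * (harm (k + j) - harm (k - j)) + m * (harm (k + j) + harm (k - j) - 2 * harm j)) x ∧
      aperyRoot (p * n + k) (p * m + j) = aperyRoot n m * aperyRoot k j * x := by
  obtain ⟨d, rfl⟩ := exists_add_of_le hm
  obtain ⟨e, rfl⟩ := exists_add_of_le hj
  have hp0 : (p : ℚ) ≠ 0 := by exact_mod_cast (Fact.out : p.Prime).ne_zero
  have h1 := isOneAddMul_factorial hp3 (m + d + m) hkj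
  have h2 := isOneAddMul_factorial hp3 m (r := j) (by omega)
  have h3 := isOneAddMul_factorial hp3 d (r := e) (by omega)
  refine ⟨_, (h1.mul ((h2.mul h2).mul h3).inv).congr_left ?_, ?_⟩
  · convert zero_mem (padicBall p 1) using 1
    rw [add_tsub_cancel_left]
    push_cast
    ring
  · rw [show p * (m + d) + (j + e) = p * m + j + (p * d + e) by ring, aperyRoot_add, aperyRoot_add,
      aperyRoot_add, show p * m + j + (p * d + e) + (p * m + j) =
        p * (m + d + m) + (j + e + j) by ring]
    field_simp
    ring

theorem aperyRoot_sq_congr (hp3 : 3 ≤ p) (hk : k < p) (hm : m ≤ n) (hj : j < p) :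
    aperyRoot (p * n + k) (p * m + j) ^ 2 - aperyRoot n m ^ 2 * aperyRoot k j ^ 2 *
      (1 + p * (2 * (n * (harm (k + j) - harm (k - j)) +
        m * (harm (k + j) + harm (k - j) - 2 * harm j)))) ∈ padicBall p 2 := by
  by_cases h : k < j ∨ p ≤ k + j
  · have hroot := aperyRoot_mem_padicBall_one n m hk hj h
    have hsmall : aperyRoot k j ∈ padicBall p 1 := by
      simpa using aperyRoot_mem_padicBall_one 0 0 hk hj h
    have hadd := harm_mem_padicBall_neg_one (show k + j < 2 * p by omega)
    have hsub := padicBall_anti (show (-1 : ℤ) ≤ 0 by norm_num)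
      (harm_mem_padicBall (show k - j < p by omega))
    have hj' := padicBall_anti (show (-1 : ℤ) ≤ 0 by norm_num) (harm_mem_padicBall hj)
    have hnat {y : ℚ} (a : ℕ) (hy : y ∈ padicBall p (-1)) : a * y ∈ padicBall p (-1) :=
      mul_mem_padicBall (natCast_mem_padicBall a) hy
    have hfactor := add_mem one_mem_padicBall (mul_mem_padicBall (d := 0) prime_mem_padicBall
      (hnat 2 (add_mem (hnat n (sub_mem hadd hsub))
        (hnat m (sub_mem (add_mem hadd hsub) (hnat 2 hj'))))))
    have hprod := mul_mem_padicBall (d := 1) (aperyRoot_mem_padicBall_zero (p := p) n m) hsmall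
    convert sub_mem (mul_mem_padicBall (d := 2) hroot hroot)
      (mul_mem_padicBall (d := 2) (mul_mem_padicBall (d := 2) hprod hprod) hfactor) using 1
    push_cast
    ring
  · push Not at h
    obtain ⟨x, hx, hroot⟩ := exists_aperyRoot_eq_mul hp3 hm h.1 h.2
    have hprod := mul_mem_padicBall (d := 0) (aperyRoot_mem_padicBall_zero (p := p) n m)
      (aperyRoot_mem_padicBall_zero k j)
    convert mul_mem_padicBall (d := 2) (mul_mem_padicBall (d := 0) hprod hprod) (hx.mul hx).2
      using 1
    rw [hroot]
    ring

theorem apery_congr (hp3 : 3 ≤ p) (n : ℕ) (hk : k < p) :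
    apery (p * n + k) - apery k * apery n - p * n * apery' k * apery n ∈ padicBall p 2 := by
  have hvanish : ∑ j ∈ range p,
      aperyRoot k j ^ 2 * (harm (k + j) + harm (k - j) - 2 * harm j) = 0 := by
    rw [← sum_aperyRoot_sq_mul_harm k]
    refine (sum_subset (range_subset_range.2 hk) fun j _ hj => ?_).symm
    rw [aperyRoot_eq_zero_of_lt (by simpa using hj), zero_pow two_ne_zero, zero_mul]
  have hterms := sum_mem fun m (hm : m ∈ range (n + 1)) => sum_mem fun j (hj : j ∈ range p) =>
    aperyRoot_sq_congr hp3 hk (le_of_lt_succ (mem_range.1 hm)) (mem_range.1 hj)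
  have hinner (m : ℕ) : ∑ j ∈ range p, aperyRoot n m ^ 2 * aperyRoot k j ^ 2 *
      (1 + p * (2 * (n * (harm (k + j) - harm (k - j)) +
        m * (harm (k + j) + harm (k - j) - 2 * harm j)))) =
      aperyRoot n m ^ 2 * (apery k + p * n * apery' k) := by
    rw [apery_eq_sum_range hk, apery'_eq_sum_range hk, ← add_zero (_ + _),
      ← mul_zero (2 * p * m : ℚ), ← hvanish]
    simp only [mul_sum, ← sum_add_distrib]
    exact sum_congr rfl fun j _ => by ring
  convert hterms using 1
  simp only [sum_sub_distrib, hinner]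
  rw [← sum_range_mul (fun i => aperyRoot (p * n + k) i ^ 2) p (n + 1),
    ← apery_eq_sum_range (by rw [mul_add_one]; omega), ← sum_mul, ← apery_eq_sum_sq]
  ring

end Congruence

end AperyNumbers

theorem gessel_lucas_apery (p : ℕ) (hp : p.Prime) (hp3 : 3 ≤ p) (n k : ℕ) (hk : k < p) :
    apery (p * n + k) - apery k * apery n - p * n * apery' k * apery n = 0 ∨
      2 ≤ padicValRat p (apery (p * n + k) - apery k * apery n - p * n * apery' k * apery n) := by
  have := Fact.mk hp
  exact mem_padicBall_iff_padicValRat.1 (apery_congr hp3 n hk)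
end
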